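/- arXiv:1212.1293 — 11 statements merged into one kernel-verified Lean document; each statement's English description precedes it below -/
import Mathlib

section
/- Let w : ℝ → ℂ be integrable on [−1,1] and satisfy w(−x) = conj(w(x)) for all x ∈ [−1,1]. Let n ≥ 1 and let p ∈ ℂ[X] be a monic polynomial of degree n with ∫_{−1}^{1} p(x)·x^k·w(x) dx = 0 for every k = 0,…,n−1, and assume p is the unique such polynomial (i.e., every monic polynomial of degree n satisfying these conditions equals p). Then for every z ∈ ℂ, p(z) = (−1)^n · conj( p(−conj(z)) ). -/
open Polynomial MeasureTheory

theorem symmetry_of_orthogonal_polynomial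
    (w : ℝ → ℂ) (n : ℕ) (hn : 1 ≤ n)
    (hw_int : IntervalIntegrable w volume (-1) 1)
    (hw_sym : ∀ x ∈ Set.Icc (-1 : ℝ) 1, w (-x) = starRingEnd ℂ (w x))
    (p : Polynomial ℂ) (hmonic : p.Monic) (hdeg : p.natDegree = n)
    (horth : ∀ k < n, ∫ x in (-1 : ℝ)..1, p.eval (x : ℂ) * (x : ℂ) ^ k * w x = 0)
    (huniq : ∀ q : Polynomial ℂ, q.Monic → q.natDegree = n →
      (∀ k < n, ∫ x in (-1 : ℝ)..1, q.eval (x : ℂ) * (x : ℂ) ^ k * w x = 0) → q = p) :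
    ∀ z : ℂ, p.eval z = (-1) ^ n * starRingEnd ℂ (p.eval (-(starRingEnd ℂ z))) := by
  have hev : ∀ z : ℂ, (C ((-1 : ℂ) ^ n) * (p.map (starRingEnd ℂ)).comp (-X)).eval z
      = (-1) ^ n * starRingEnd ℂ (p.eval (-(starRingEnd ℂ z))) := by
    intro z
    have h1 : (p.map (starRingEnd ℂ)).eval (-z)
        = starRingEnd ℂ (p.eval (-(starRingEnd ℂ z))) := by
      have h2 : -z = starRingEnd ℂ (-(starRingEnd ℂ z)) := by simp
      rw [h2, Polynomial.eval_map, Polynomial.eval₂_hom]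
    rw [eval_mul, eval_C, eval_comp, eval_neg, eval_X, h1]
  have hnd : ((p.map (starRingEnd ℂ)).comp (-X)).natDegree = n := by
    rw [natDegree_comp, natDegree_map, natDegree_neg, natDegree_X, mul_one, hdeg]
  have hne : ((-1 : ℂ) ^ n) ≠ 0 := pow_ne_zero _ (by norm_num)
  have hq := huniq (C ((-1 : ℂ) ^ n) * (p.map (starRingEnd ℂ)).comp (-X)) ?_ ?_ ?_
  · intro z
    rw [← hev z, hq]
  · unfold Monic
    rw [leadingCoeff_mul, leadingCoeff_C, leadingCoeff_comp (by simp), leadingCoeff_neg,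
      leadingCoeff_X, (hmonic.map _).leadingCoeff, natDegree_map, hdeg, one_mul, ← mul_pow]
    simp
  · rw [natDegree_C_mul hne, hnd]
  · intro k hk
    have h0 := intervalIntegral.integral_comp_neg (a := (-1 : ℝ)) (b := 1)
      (fun x : ℝ => (C ((-1 : ℂ) ^ n) * (p.map (starRingEnd ℂ)).comp (-X)).eval (x : ℂ)
        * (x : ℂ) ^ k * w x)
    rw [neg_neg] at h0
    rw [← h0]
    have h1 : ∫ x in (-1 : ℝ)..1, (C ((-1 : ℂ) ^ n) * (p.map (starRingEnd ℂ)).comp (-X)).eval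
        ((-x : ℝ) : ℂ) * ((-x : ℝ) : ℂ) ^ k * w (-x)
        = ∫ x in (-1 : ℝ)..1, ((-1) ^ n * (-1) ^ k) *
          starRingEnd ℂ (p.eval (x : ℂ) * (x : ℂ) ^ k * w x) := by
      apply intervalIntegral.integral_congr
      intro x hx
      rw [Set.uIcc_of_le (by norm_num)] at hx
      simp only []
      rw [hev, hw_sym x hx]
      simp only [map_mul, map_pow, Complex.conj_ofReal, Complex.ofReal_neg, map_neg, neg_neg]
      rw [neg_pow (x : ℂ) k]
      ring
    rw [h1, intervalIntegral.integral_const_mul]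
    have h2 : ∫ x in (-1 : ℝ)..1, starRingEnd ℂ (p.eval (x : ℂ) * (x : ℂ) ^ k * w x) = 0 := by
      rw [intervalIntegral.integral_of_le (by norm_num), integral_conj,
        ← intervalIntegral.integral_of_le (by norm_num), horth k hk, map_zero]
    rw [h2, mul_zero]
end

section
/- Let ω ∈ ℝ, n ≥ 1, and let p ∈ ℂ[X] be a monic polynomial of degree n with ∫_{−1}^{1} p(x)·x^k·e^{iωx} dx = 0 for every k = 0,…,n−1, and assume p is the unique such polynomial. Then for every real y: if n is even, then p(iy) is real (its imaginary part is 0), and if n is odd, then p(iy) is purely imaginary (its real part is 0). -/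
open Polynomial MeasureTheory

theorem orthogonal_polynomial_real_or_imaginary_on_imaginary_axis
    (ω : ℝ) (n : ℕ) (hn : 1 ≤ n)
    (p : Polynomial ℂ) (hmonic : p.Monic) (hdeg : p.natDegree = n)
    (horth : ∀ k < n, ∫ x in (-1 : ℝ)..1,
      p.eval (x : ℂ) * (x : ℂ) ^ k * Complex.exp (Complex.I * ω * x) = 0)
    (huniq : ∀ q : Polynomial ℂ, q.Monic → q.natDegree = n →
      (∀ k < n, ∫ x in (-1 : ℝ)..1,
        q.eval (x : ℂ) * (x : ℂ) ^ k * Complex.exp (Complex.I * ω * x) = 0) → q = p) :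
    ∀ y : ℝ, (Even n → (p.eval (Complex.I * y)).im = 0) ∧
      (Odd n → (p.eval (Complex.I * y)).re = 0) := by
  have hev : ∀ z : ℂ, ((C ((-1 : ℂ) ^ n) * (p.map (starRingEnd ℂ)).comp (-X)).eval z)
      = (-1) ^ n * (starRingEnd ℂ) (p.eval ((starRingEnd ℂ) (-z))) := by
    intro z
    have h := Polynomial.eval_map_apply (p := p) (starRingEnd ℂ) ((starRingEnd ℂ) (-z))
    rw [Complex.conj_conj] at h
    rw [eval_mul, eval_C, eval_comp, eval_neg, eval_X, h]
  have hmd : (p.map (starRingEnd ℂ)).natDegree = n := by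
    rw [natDegree_map, hdeg]
  have hq := huniq (C ((-1 : ℂ) ^ n) * (p.map (starRingEnd ℂ)).comp (-X)) ?_ ?_ ?_
  · intro y
    have h := hev (Complex.I * y)
    rw [hq] at h
    have h2 : (starRingEnd ℂ) (-(Complex.I * (y : ℂ))) = Complex.I * y := by
      simp
    rw [h2] at h
    constructor
    · intro he
      rw [he.neg_one_pow, one_mul] at h
      have := congrArg Complex.im h
      rw [Complex.conj_im] at this
      linarith
    · intro ho
      rw [ho.neg_one_pow] at h
      have := congrArg Complex.re h
      rw [neg_one_mul, Complex.neg_re, Complex.conj_re] at this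
      linarith
  · have hm : (p.map (starRingEnd ℂ)).Monic := hmonic.map _
    have := hm.neg_one_pow_natDegree_mul_comp_neg_X
    rw [hmd] at this
    simpa using this
  · rw [natDegree_C_mul (by simp), natDegree_comp, natDegree_neg, natDegree_X, hmd, mul_one]
  · intro k hk
    have h0 := horth k hk
    have h1 := intervalIntegral.integral_comp_neg (a := -1) (b := 1) (fun x : ℝ =>
      (C ((-1 : ℂ) ^ n) * (p.map (starRingEnd ℂ)).comp (-X)).eval (x : ℂ) * (x : ℂ) ^ k
        * Complex.exp (Complex.I * ω * x))
    rw [neg_neg] at h1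
    rw [← h1]
    have h2 : ∀ x : ℝ, (C ((-1 : ℂ) ^ n) * (p.map (starRingEnd ℂ)).comp (-X)).eval ((-x : ℝ) : ℂ)
        * ((-x : ℝ) : ℂ) ^ k * Complex.exp (Complex.I * ω * ((-x : ℝ) : ℂ))
        = ((-1) ^ n * (-1) ^ k) * (starRingEnd ℂ)
          (p.eval (x : ℂ) * (x : ℂ) ^ k * Complex.exp (Complex.I * ω * x)) := by
      intro x
      rw [hev, map_mul, map_mul, map_pow, ← Complex.exp_conj]
      simp only [map_mul, Complex.conj_I, Complex.conj_ofReal, Complex.ofReal_neg, neg_neg]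
      rw [neg_pow (x : ℂ) k]
      have : Complex.I * (ω : ℂ) * -(x : ℂ) = -Complex.I * ω * x := by ring
      rw [this]
      ring
    simp only [h2]
    rw [intervalIntegral.integral_const_mul]
    have h3 : ∫ x in (-1 : ℝ)..1, (starRingEnd ℂ)
          (p.eval (x : ℂ) * (x : ℂ) ^ k * Complex.exp (Complex.I * ω * x)) = 0 := by
      rw [intervalIntegral.integral_of_le (by norm_num)] at h0 ⊢
      rw [integral_conj, h0, map_zero]
    rw [h3, mul_zero]
end

section
/- Let ω ∈ ℝ, n ≥ 1, and let p ∈ ℂ[X] be a monic polynomial of degree n with ∫_{−1}^{1} p(x)·x^k·e^{iωx} dx = 0 for every k = 0,…,n−1, and assume p is the unique such polynomial. Then the multiset of roots of p (with multiplicity, over ℂ) is invariant under the map z ↦ −conj(z); in particular, if n is odd then p has at least one root lying on the imaginary axis (a root with real part 0). -/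
open Polynomial MeasureTheory

theorem eval_prod_aux (s : Multiset ℂ) (x : ℝ) :
    (((s.map (fun z => -(starRingEnd ℂ z))).map (fun a => X - C a)).prod).eval (x : ℂ) =
    (-1) ^ (Multiset.card s) *
      starRingEnd ℂ (((s.map (fun a => X - C a)).prod).eval ((-x : ℝ) : ℂ)) := by
  induction s using Multiset.induction_on with
  | empty => simp
  | cons a s ih =>
    simp only [Multiset.map_cons, Multiset.prod_cons, eval_mul, ih, Multiset.card_cons, map_mul]
    simp only [eval_sub, eval_X, eval_C, map_sub, Complex.conj_ofReal]
    push_cast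
    ring

theorem even_aux (s : Multiset ℂ) (h : s.map (fun z => -(starRingEnd ℂ z)) = s)
    (hs : ∀ z ∈ s, z.re ≠ 0) : Even (Multiset.card s) := by
  classical
  have h1 : s.countP (fun z => 0 < z.re) = s.countP (fun z => ¬ 0 < z.re) := by
    conv_lhs => rw [← h]
    rw [Multiset.countP_map, ← Multiset.countP_eq_card_filter]
    apply Multiset.countP_congr rfl
    intro z hz
    have := hs z hz
    simp only [Complex.neg_re, Complex.conj_re, eq_iff_iff, not_lt, Left.neg_pos_iff]
    exact ⟨le_of_lt, fun h => lt_of_le_of_ne h this⟩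
  rw [Multiset.card_eq_countP_add_countP (fun z : ℂ => 0 < z.re) s, h1]
  exact ⟨_, rfl⟩

theorem roots_symmetric_wrt_imaginary_axis
    (ω : ℝ) (n : ℕ) (hn : 1 ≤ n)
    (p : Polynomial ℂ) (hmonic : p.Monic) (hdeg : p.natDegree = n)
    (horth : ∀ k < n, ∫ x in (-1 : ℝ)..1,
      p.eval (x : ℂ) * (x : ℂ) ^ k * Complex.exp (Complex.I * ω * x) = 0)
    (huniq : ∀ q : Polynomial ℂ, q.Monic → q.natDegree = n →
      (∀ k < n, ∫ x in (-1 : ℝ)..1,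
        q.eval (x : ℂ) * (x : ℂ) ^ k * Complex.exp (Complex.I * ω * x) = 0) → q = p) :
    p.roots.map (fun z => -(starRingEnd ℂ z)) = p.roots ∧
      (Odd n → ∃ z ∈ p.roots, z.re = 0) := by
  have hsplit : p.Splits := IsAlgClosed.splits p
  have hcard : Multiset.card p.roots = n := by
    rw [← hdeg]; exact hsplit.natDegree_eq_card_roots.symm
  have hprod : (p.roots.map (fun a => X - C a)).prod = p :=
    (hsplit.eq_prod_roots_of_monic hmonic).symm
  have hq := huniq (((p.roots.map (fun z => -(starRingEnd ℂ z))).map (fun a => X - C a)).prod)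
    (monic_multiset_prod_of_monic _ _ (fun a _ => monic_X_sub_C a))
    (by rw [natDegree_multiset_prod_X_sub_C_eq_card, Multiset.card_map, hcard])
    (by
      intro k hk
      have h0 := horth k hk
      have h1 : ∀ x : ℝ, eval (x : ℂ)
          (((p.roots.map (fun z => -(starRingEnd ℂ z))).map (fun a => X - C a)).prod) *
          (x : ℂ) ^ k * Complex.exp (Complex.I * ω * x) =
          (-1) ^ (n + k) * (fun y : ℝ => starRingEnd ℂ (p.eval (y : ℂ) * (y : ℂ) ^ k *
            Complex.exp (Complex.I * ω * y))) (-x) := by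
        intro x
        rw [eval_prod_aux, hprod, hcard]
        simp only [map_mul, map_pow, Complex.conj_ofReal, ← Complex.exp_conj, Complex.conj_I]
        push_cast
        rw [neg_pow (x : ℂ) k, pow_add]
        have : ((-1 : ℂ) ^ k) * (-1) ^ k = 1 := by rw [← mul_pow]; simp
        have h2 : -Complex.I * ω * -(x : ℂ) = Complex.I * ω * x := by ring
        rw [h2]
        linear_combination (-(-1 : ℂ) ^ n * starRingEnd ℂ (p.eval (-(x : ℂ))) * (x : ℂ) ^ k *
          Complex.exp (Complex.I * ω * x)) * this
      simp_rw [h1]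
      rw [intervalIntegral.integral_const_mul, intervalIntegral.integral_comp_neg
        (fun y : ℝ => starRingEnd ℂ (p.eval (y : ℂ) * (y : ℂ) ^ k *
            Complex.exp (Complex.I * ω * y)))]
      rw [neg_neg, intervalIntegral.integral_of_le (by norm_num), integral_conj,
        ← intervalIntegral.integral_of_le (by norm_num), h0]
      simp)
  have hsym : p.roots.map (fun z => -(starRingEnd ℂ z)) = p.roots := by
    have := congrArg Polynomial.roots hq
    rwa [roots_multiset_prod_X_sub_C] at this
  refine ⟨hsym, fun hodd => ?_⟩
  by_contra hcon
  have := even_aux p.roots hsym (fun z hz h => hcon ⟨z, hz, h⟩)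
  rw [hcard] at this
  exact (Nat.not_even_iff_odd.mpr hodd) this
end

section
/- Let n ≥ 1 and let p : ℝ → ℂ[X] assign to each ω a monic polynomial p(ω) of degree n with ∫_{−1}^{1} p(ω)(x)·x^k·e^{iωx} dx = 0 for every k = 0,…,n−1 and every ω in a neighborhood of ω₀ ∈ ℝ. Assume that for each k the coefficient function ω ↦ coeff_k(p(ω)) is differentiable at ω₀, and let q ∈ ℂ[X] denote the coefficient-wise derivative of p at ω₀ (a polynomial of degree at most n−1, since p(ω) is monic). Then ∫_{−1}^{1} q(x)·x^k·e^{iω₀x} dx = 0 for every k = 0,…,n−2. -/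
open Polynomial MeasureTheory

noncomputable def momM (j : ℕ) (ω : ℝ) : ℂ :=
  ∫ x in (-1 : ℝ)..1, (x : ℂ) ^ j * Complex.exp (Complex.I * ω * x)

theorem momM_hasDerivAt (j : ℕ) (ω₀ : ℝ) :
    HasDerivAt (momM j) (Complex.I * momM (j + 1) ω₀) ω₀ := by
  have h := (intervalIntegral.hasDerivAt_integral_of_dominated_loc_of_deriv_le
    (μ := volume) (a := (-1 : ℝ)) (b := 1) (x₀ := ω₀) (s := Set.univ) (bound := fun _ => (1 : ℝ))
    (F := fun (ω : ℝ) (x : ℝ) => (x : ℂ) ^ j * Complex.exp (Complex.I * ω * x))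
    (F' := fun (ω : ℝ) (x : ℝ) => Complex.I * ((x : ℂ) ^ (j + 1) * Complex.exp (Complex.I * ω * x)))
    Filter.univ_mem
    (Filter.Eventually.of_forall fun ω => by
      apply Continuous.aestronglyMeasurable; fun_prop)
    (by apply Continuous.intervalIntegrable; fun_prop)
    (by apply Continuous.aestronglyMeasurable; fun_prop)
    (Filter.Eventually.of_forall fun x hx ω _ => by
      rw [Set.uIoc_of_le (by norm_num)] at hx
      have h1 : ‖Complex.exp (Complex.I * ω * x)‖ = 1 := by
        have := Complex.norm_exp_ofReal_mul_I (ω * x)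
        rw [← this]; congr 2; push_cast; ring
      rw [norm_mul, norm_mul, h1, Complex.norm_I, one_mul, mul_one, norm_pow, Complex.norm_real]
      apply pow_le_one₀ (norm_nonneg _)
      rw [Real.norm_eq_abs, abs_le]
      exact ⟨hx.1.le, hx.2⟩)
    (by apply Continuous.intervalIntegrable; fun_prop)
    (Filter.Eventually.of_forall fun x hx ω _ => by
      have h1 : HasDerivAt (fun ω : ℝ => (ω : ℂ)) 1 ω := Complex.ofRealCLM.hasDerivAt
      have h2 := (((h1.const_mul Complex.I).mul_const (x : ℂ)).cexp).const_mul ((x : ℂ) ^ j)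
      refine h2.congr_deriv ?_
      rw [pow_succ]
      ring)).2
  rw [intervalIntegral.integral_const_mul] at h
  exact h

theorem integral_eq_momM (P : Polynomial ℂ) (N : ℕ) (hP : P.natDegree < N) (k : ℕ) (ω : ℝ) :
    ∫ x in (-1 : ℝ)..1, P.eval (x : ℂ) * (x : ℂ) ^ k * Complex.exp (Complex.I * ω * x)
      = ∑ j ∈ Finset.range N, P.coeff j * momM (j + k) ω := by
  unfold momM
  simp_rw [← intervalIntegral.integral_const_mul]
  rw [← intervalIntegral.integral_finsetSum]
  · congr 1
    ext x
    rw [Polynomial.eval_eq_sum_range' hP, Finset.sum_mul, Finset.sum_mul]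
    refine Finset.sum_congr rfl fun j _ => ?_
    rw [pow_add]; ring
  · intro j _
    apply Continuous.intervalIntegrable; fun_prop

theorem derivative_of_orthogonal_polynomial_is_orthogonal
    (n : ℕ) (hn : 1 ≤ n) (ω₀ : ℝ) (p : ℝ → Polynomial ℂ) (q : Polynomial ℂ)
    (hmonic : ∀ᶠ ω in nhds ω₀, (p ω).Monic ∧ (p ω).natDegree = n)
    (horth : ∀ᶠ ω in nhds ω₀, ∀ k < n, ∫ x in (-1 : ℝ)..1,
      (p ω).eval (x : ℂ) * (x : ℂ) ^ k * Complex.exp (Complex.I * ω * x) = 0)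
    (hderiv : ∀ k : ℕ, HasDerivAt (fun ω => (p ω).coeff k) (q.coeff k) ω₀) :
    ∀ k < n - 1, ∫ x in (-1 : ℝ)..1,
      q.eval (x : ℂ) * (x : ℂ) ^ k * Complex.exp (Complex.I * ω₀ * x) = 0 := by
  intro k hk
  have hq : q.natDegree < n + 1 := by
    rw [Nat.lt_succ_iff, Polynomial.natDegree_le_iff_coeff_eq_zero]
    intro j hj
    have h0 : (fun ω => (p ω).coeff j) =ᶠ[nhds ω₀] fun _ => (0 : ℂ) := by
      filter_upwards [hmonic] with ω h
      exact Polynomial.coeff_eq_zero_of_natDegree_lt (by omega)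
    exact (hderiv j).unique ((hasDerivAt_const ω₀ (0 : ℂ)).congr_of_eventuallyEq h0)
  rw [integral_eq_momM q (n + 1) hq]
  have hS := HasDerivAt.fun_sum (u := Finset.range (n + 1))
    fun j _ => (hderiv j).fun_mul (momM_hasDerivAt (j + k) ω₀)
  have hZ : (fun ω => ∑ j ∈ Finset.range (n + 1), (p ω).coeff j * momM (j + k) ω)
      =ᶠ[nhds ω₀] fun _ => (0 : ℂ) := by
    filter_upwards [hmonic, horth] with ω h1 h2
    rw [← integral_eq_momM (p ω) (n + 1) (by omega)]
    exact h2 k (by omega)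
  have h := hS.unique ((hasDerivAt_const ω₀ (0 : ℂ)).congr_of_eventuallyEq hZ)
  have h3 := horth.self_of_nhds (k + 1) (by omega)
  rw [integral_eq_momM (p ω₀) (n + 1) (by have := hmonic.self_of_nhds; omega)] at h3
  rw [Finset.sum_add_distrib] at h
  have h4 : ∑ j ∈ Finset.range (n + 1), (p ω₀).coeff j * (Complex.I * momM (j + k + 1) ω₀) = 0 := by
    rw [← mul_zero Complex.I, ← h3, Finset.mul_sum]
    refine Finset.sum_congr rfl fun j _ => ?_
    rw [← add_assoc]; ring
  rw [h4, add_zero] at h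
  exact h
end

section
/- Let n ≥ 1 and let p : ℝ → ℂ[X] assign to each ω a monic polynomial p(ω) of degree n with ∫_{−1}^{1} p(ω)(x)·x^k·e^{iωx} dx = 0 for every k = 0,…,n−1 and every ω in a neighborhood of ω₀ ∈ ℝ, with each coefficient function ω ↦ coeff_k(p(ω)) differentiable at ω₀; let q be the coefficient-wise derivative of p at ω₀. Let r ∈ ℂ[X] be a monic polynomial of degree n−1 with ∫_{−1}^{1} r(x)·x^k·e^{iω₀x} dx = 0 for every k = 0,…,n−2, and assume every polynomial of degree at most n−1 satisfying these n−1 orthogonality conditions at ω₀ is a scalar multiple of r. Assume moreover (r,r) := ∫_{−1}^{1} r(x)²·e^{iω₀x} dx ≠ 0. Then q = −i·β·r, where β = (∫_{−1}^{1} p(ω₀)(x)²·e^{iω₀x} dx) / (∫_{−1}^{1} r(x)²·e^{iω₀x} dx). -/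
open Polynomial MeasureTheory

noncomputable def MM (j : ℕ) (ω : ℝ) : ℂ :=
  ∫ x in (-1 : ℝ)..1, (x : ℂ) ^ j * Complex.exp (Complex.I * ω * x)

lemma MM_deriv (j : ℕ) (ω₀ : ℝ) : HasDerivAt (MM j) (Complex.I * MM (j+1) ω₀) ω₀ := by
  have h := intervalIntegral.hasDerivAt_integral_of_dominated_loc_of_deriv_le (𝕜 := ℝ)
    (μ := volume) (a := -1) (b := 1)
    (F := fun (ω : ℝ) (x : ℝ) => (x : ℂ) ^ j * Complex.exp (Complex.I * ω * x))
    (F' := fun (ω : ℝ) (x : ℝ) => Complex.I * ((x : ℂ) ^ (j+1) * Complex.exp (Complex.I * ω * x)))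
    (x₀ := ω₀) (s := Set.univ) (bound := fun _ => 1) Filter.univ_mem
    (Filter.Eventually.of_forall fun ω => by
      apply Continuous.aestronglyMeasurable; fun_prop)
    (by apply Continuous.intervalIntegrable; fun_prop)
    (by apply Continuous.aestronglyMeasurable; fun_prop)
    (Filter.Eventually.of_forall fun x hx ω _ => by
      rw [Set.uIoc_of_le (by norm_num)] at hx
      have h1 : ‖Complex.exp (Complex.I * ω * x)‖ = 1 := by
        rw [Complex.norm_exp]; simp
      rw [norm_mul, norm_mul, h1, norm_pow, Complex.norm_I, Complex.norm_real, one_mul, mul_one]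
      exact pow_le_one₀ (norm_nonneg _) (abs_le.2 ⟨hx.1.le, hx.2⟩))
    (by simp)
    (Filter.Eventually.of_forall fun x hx ω _ => by
      have h1 : HasDerivAt (fun ω : ℝ => Complex.I * (ω : ℂ) * x) (Complex.I * 1 * x) ω :=
        ((Complex.ofRealCLM.hasDerivAt (x := ω)).const_mul Complex.I).mul_const _
      have := (h1.cexp).const_mul ((x : ℂ) ^ j)
      refine HasDerivAt.congr_deriv this ?_
      ring)
  have h2 := h.2
  rw [intervalIntegral.integral_const_mul] at h2
  exact h2

lemma expand (g : Polynomial ℂ) (N : ℕ) (hN : g.natDegree < N) (h : ℝ → ℂ) (hh : Continuous h) :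
    ∫ x in (-1 : ℝ)..1, g.eval (x : ℂ) * h x =
      ∑ j ∈ Finset.range N, g.coeff j * ∫ x in (-1 : ℝ)..1, (x : ℂ) ^ j * h x := by
  simp_rw [eval_eq_sum_range' hN, Finset.sum_mul]
  rw [intervalIntegral.integral_finsetSum]
  · refine Finset.sum_congr rfl fun j _ => ?_
    rw [← intervalIntegral.integral_const_mul]
    simp_rw [mul_assoc]
  · intro j _
    apply Continuous.intervalIntegrable
    fun_prop

lemma expandM (g : Polynomial ℂ) (N : ℕ) (hN : g.natDegree < N) (k : ℕ) (ω : ℝ) :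
    ∫ x in (-1 : ℝ)..1, g.eval (x : ℂ) * (x : ℂ) ^ k * Complex.exp (Complex.I * ω * x) =
      ∑ j ∈ Finset.range N, g.coeff j * MM (j + k) ω := by
  have := expand g N hN (fun x => (x : ℂ) ^ k * Complex.exp (Complex.I * ω * x)) (by fun_prop)
  simp only [← mul_assoc, ← pow_add] at this
  exact this

lemma sq_int (f : Polynomial ℂ) (m : ℕ) (hf : f.Monic) (hm : f.natDegree = m) (ω : ℝ)
    (ho : ∀ k < m, ∫ x in (-1 : ℝ)..1,
      f.eval (x : ℂ) * (x : ℂ) ^ k * Complex.exp (Complex.I * ω * x) = 0) :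
    ∫ x in (-1 : ℝ)..1, (f.eval (x : ℂ)) ^ 2 * Complex.exp (Complex.I * ω * x) =
    ∫ x in (-1 : ℝ)..1, f.eval (x : ℂ) * (x : ℂ) ^ m * Complex.exp (Complex.I * ω * x) := by
  have := expand f (m+1) (by omega)
    (fun x => f.eval (x : ℂ) * Complex.exp (Complex.I * ω * x)) (by fun_prop)
  have e : ∀ j : ℕ, (∫ x in (-1 : ℝ)..1, (x : ℂ) ^ j *
      (f.eval (x : ℂ) * Complex.exp (Complex.I * ω * x))) =
      ∫ x in (-1 : ℝ)..1, f.eval (x : ℂ) * (x : ℂ) ^ j * Complex.exp (Complex.I * ω * x) := by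
    intro j; congr 1; ext x; ring
  simp only [e] at this
  rw [Finset.sum_range_succ, Finset.sum_eq_zero (fun j hj => by
    rw [ho j (Finset.mem_range.1 hj), mul_zero]), zero_add] at this
  have hc : f.coeff m = 1 := by rw [← hm]; exact hf
  rw [hc, one_mul] at this
  rw [← this]
  congr 1; ext x; ring

theorem derivative_of_orthogonal_polynomial_formula
    (n : ℕ) (hn : 1 ≤ n) (ω₀ : ℝ) (p : ℝ → Polynomial ℂ) (q : Polynomial ℂ)
    (hmonic : ∀ᶠ ω in nhds ω₀, (p ω).Monic ∧ (p ω).natDegree = n)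
    (horth : ∀ᶠ ω in nhds ω₀, ∀ k < n, ∫ x in (-1 : ℝ)..1,
      (p ω).eval (x : ℂ) * (x : ℂ) ^ k * Complex.exp (Complex.I * ω * x) = 0)
    (hderiv : ∀ k : ℕ, HasDerivAt (fun ω => (p ω).coeff k) (q.coeff k) ω₀)
    (r : Polynomial ℂ) (hrmonic : r.Monic) (hrdeg : r.natDegree = n - 1)
    (hrorth : ∀ k < n - 1, ∫ x in (-1 : ℝ)..1,
      r.eval (x : ℂ) * (x : ℂ) ^ k * Complex.exp (Complex.I * ω₀ * x) = 0)
    (hruniq : ∀ s : Polynomial ℂ, s.natDegree ≤ n - 1 →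
      (∀ k < n - 1, ∫ x in (-1 : ℝ)..1,
        s.eval (x : ℂ) * (x : ℂ) ^ k * Complex.exp (Complex.I * ω₀ * x) = 0) →
      ∃ c : ℂ, s = Polynomial.C c * r)
    (hrr : (∫ x in (-1 : ℝ)..1,
      (r.eval (x : ℂ)) ^ 2 * Complex.exp (Complex.I * ω₀ * x)) ≠ 0) :
    q = Polynomial.C (-Complex.I *
      ((∫ x in (-1 : ℝ)..1, ((p ω₀).eval (x : ℂ)) ^ 2 * Complex.exp (Complex.I * ω₀ * x)) /
       (∫ x in (-1 : ℝ)..1, (r.eval (x : ℂ)) ^ 2 * Complex.exp (Complex.I * ω₀ * x)))) * r := by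
  obtain ⟨hpm, hpd⟩ := hmonic.self_of_nhds
  have hpo := horth.self_of_nhds
  have hq0 : ∀ j, n ≤ j → q.coeff j = 0 := by
    intro j hj
    have : (fun ω => (p ω).coeff j) =ᶠ[nhds ω₀] fun _ => (if j = n then (1:ℂ) else 0) := by
      filter_upwards [hmonic] with ω hω
      split_ifs with h
      · rw [h, ← hω.2]; exact hω.1
      · exact coeff_eq_zero_of_natDegree_lt (by omega)
    exact (hderiv j).unique ((hasDerivAt_const ω₀ _).congr_of_eventuallyEq this)
  have hqd : q.natDegree ≤ n - 1 := by
    rw [natDegree_le_iff_coeff_eq_zero]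
    intro j hj
    exact hq0 j (by omega)
  have key : ∀ k < n, (∫ x in (-1 : ℝ)..1,
      q.eval (x : ℂ) * (x : ℂ) ^ k * Complex.exp (Complex.I * ω₀ * x)) =
      -Complex.I * ∫ x in (-1 : ℝ)..1,
      (p ω₀).eval (x : ℂ) * (x : ℂ) ^ (k+1) * Complex.exp (Complex.I * ω₀ * x) := by
    intro k hk
    rw [expandM q (n+1) (by omega), expandM (p ω₀) (n+1) (by omega)]
    have h1 : HasDerivAt (fun ω => ∑ j ∈ Finset.range (n+1), (p ω).coeff j * MM (j + k) ω)
        (∑ j ∈ Finset.range (n+1), (q.coeff j * MM (j+k) ω₀ +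
          (p ω₀).coeff j * (Complex.I * MM (j+k+1) ω₀))) ω₀ :=
      HasDerivAt.fun_sum fun j _ => (hderiv j).mul (MM_deriv (j+k) ω₀)
    have h2 : (fun ω => ∑ j ∈ Finset.range (n+1), (p ω).coeff j * MM (j + k) ω)
        =ᶠ[nhds ω₀] fun _ => 0 := by
      filter_upwards [hmonic, horth] with ω h h'
      rw [← expandM (p ω) (n+1) (by omega)]
      exact h' k hk
    have h3 := h1.unique ((hasDerivAt_const ω₀ _).congr_of_eventuallyEq h2)
    rw [Finset.sum_add_distrib] at h3
    rw [eq_neg_of_add_eq_zero_left h3, Finset.mul_sum, ← Finset.sum_neg_distrib]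
    refine Finset.sum_congr rfl fun j _ => ?_
    rw [← add_assoc]; ring
  obtain ⟨c, hc⟩ := hruniq q hqd fun k hk => by
    rw [key k (by omega), hpo (k+1) (by omega), mul_zero]
  have hl := key (n-1) (by omega)
  rw [Nat.sub_add_cancel hn, ← sq_int (p ω₀) n hpm hpd ω₀ hpo, hc] at hl
  simp only [eval_mul, eval_C, mul_assoc c] at hl
  rw [intervalIntegral.integral_const_mul, ← sq_int r (n-1) hrmonic hrdeg ω₀ hrorth] at hl
  rw [hc, ← mul_div_assoc, ← hl, mul_div_cancel_right₀ _ hrr]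
end

section
/- Let k ≥ 2 and, for j ∈ {k−2, k−1, k, k+1}, let p_j : ℝ → ℂ[X] assign to each ω a monic polynomial of degree j, and let α_{k−1}, α_k, β_{k−1}, β_k, β_{k+1} : ℝ → ℂ. Assume that for all ω in a neighborhood of ω₀ ∈ ℝ the three-term recurrences p_{k+1}(ω) = (X − α_k(ω))·p_k(ω) − β_k(ω)·p_{k−1}(ω) and p_k(ω) = (X − α_{k−1}(ω))·p_{k−1}(ω) − β_{k−1}(ω)·p_{k−2}(ω) hold; that each coefficient of p_{k+1}, p_k, p_{k−1} is differentiable at ω₀ and the coefficient-wise derivatives satisfy ∂_ω p_j(ω₀) = −i·β_j(ω₀)·p_{j−1}(ω₀) for j ∈ {k−1, k, k+1}; that α_k and β_k are differentiable at ω₀; and that β_k(ω₀) ≠ 0. Then β_{k+1}(ω₀) = β_k(ω₀) − i·α_k′(ω₀) and α_{k−1}(ω₀) = α_k(ω₀) + i·β_k′(ω₀)/β_k(ω₀). -/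
open Polynomial

theorem deformation_equations_for_recurrence_coefficients
    (k : ℕ) (hk : 2 ≤ k) (ω₀ : ℝ)
    (pkm2 pkm1 pk pkp1 : ℝ → Polynomial ℂ)
    (αkm1 αk βkm1 βk βkp1 : ℝ → ℂ)
    (hmon2 : ∀ ω : ℝ, (pkm2 ω).Monic ∧ (pkm2 ω).natDegree = k - 2)
    (hmon1 : ∀ ω : ℝ, (pkm1 ω).Monic ∧ (pkm1 ω).natDegree = k - 1)
    (hmon0 : ∀ ω : ℝ, (pk ω).Monic ∧ (pk ω).natDegree = k)
    (hmonp : ∀ ω : ℝ, (pkp1 ω).Monic ∧ (pkp1 ω).natDegree = k + 1)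
    (hrec1 : ∀ᶠ ω in nhds ω₀,
      pkp1 ω = (X - Polynomial.C (αk ω)) * pk ω - Polynomial.C (βk ω) * pkm1 ω)
    (hrec2 : ∀ᶠ ω in nhds ω₀,
      pk ω = (X - Polynomial.C (αkm1 ω)) * pkm1 ω - Polynomial.C (βkm1 ω) * pkm2 ω)
    (hd1 : ∀ m : ℕ, HasDerivAt (fun ω => (pkp1 ω).coeff m)
      ((Polynomial.C (-Complex.I * βkp1 ω₀) * pk ω₀).coeff m) ω₀)
    (hd2 : ∀ m : ℕ, HasDerivAt (fun ω => (pk ω).coeff m)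
      ((Polynomial.C (-Complex.I * βk ω₀) * pkm1 ω₀).coeff m) ω₀)
    (hd3 : ∀ m : ℕ, HasDerivAt (fun ω => (pkm1 ω).coeff m)
      ((Polynomial.C (-Complex.I * βkm1 ω₀) * pkm2 ω₀).coeff m) ω₀)
    (hα : DifferentiableAt ℝ αk ω₀) (hβ : DifferentiableAt ℝ βk ω₀)
    (hβne : βk ω₀ ≠ 0) :
    βkp1 ω₀ = βk ω₀ - Complex.I * deriv αk ω₀ ∧
      αkm1 ω₀ = αk ω₀ + Complex.I * deriv βk ω₀ / βk ω₀ := by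
  have h1 := hrec1.self_of_nhds
  have h2 := hrec2.self_of_nhds
  have key : Polynomial.C (-Complex.I * βkp1 ω₀) * pk ω₀
      = (X - Polynomial.C (αk ω₀)) * (Polynomial.C (-Complex.I * βk ω₀) * pkm1 ω₀)
        - Polynomial.C (deriv αk ω₀) * pk ω₀ - Polynomial.C (deriv βk ω₀) * pkm1 ω₀
        - Polynomial.C (βk ω₀) * (Polynomial.C (-Complex.I * βkm1 ω₀) * pkm2 ω₀) := by
    ext m
    have hX : HasDerivAt (fun ω => (X * pk ω).coeff m)
        ((X * (Polynomial.C (-Complex.I * βk ω₀) * pkm1 ω₀)).coeff m) ω₀ := by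
      cases m with
      | zero =>
        simp only [coeff_X_mul_zero]
        exact hasDerivAt_const _ _
      | succ m =>
        simp only [coeff_X_mul]
        exact hd2 m
    have hR := (hX.sub (hα.hasDerivAt.mul (hd2 m))).sub (hβ.hasDerivAt.mul (hd3 m))
    have hL := (hd1 m).congr_of_eventuallyEq (f₁ := (fun ω => (X * pk ω).coeff m)
        - (αk * fun ω => (pk ω).coeff m) - (βk * fun ω => (pkm1 ω).coeff m)) (by
      filter_upwards [hrec1] with ω hω
      simp [hω, sub_mul])
    have hu := hL.unique hR
    rw [hu]
    simp only [sub_mul, coeff_sub, coeff_C_mul]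
    ring
  have hcomb : Polynomial.C (-Complex.I * βkp1 ω₀ + Complex.I * βk ω₀ + deriv αk ω₀) * pk ω₀
      = Polynomial.C (Complex.I * βk ω₀ * (αk ω₀ - αkm1 ω₀) - deriv βk ω₀) * pkm1 ω₀ := by
    simp only [map_add, map_mul, map_sub, map_neg] at key h2 ⊢
    linear_combination key + Polynomial.C Complex.I * Polynomial.C (βk ω₀) * h2
  have hk1 : (pk ω₀).coeff k = 1 := by
    have := (hmon0 ω₀).1.coeff_natDegree
    rwa [(hmon0 ω₀).2] at this
  have hk2 : (pkm1 ω₀).coeff k = 0 :=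
    coeff_eq_zero_of_natDegree_lt (by rw [(hmon1 ω₀).2]; omega)
  have hk3 : (pkm1 ω₀).coeff (k - 1) = 1 := by
    have := (hmon1 ω₀).1.coeff_natDegree
    rwa [(hmon1 ω₀).2] at this
  have e1 : -Complex.I * βkp1 ω₀ + Complex.I * βk ω₀ + deriv αk ω₀ = 0 := by
    have := congrArg (fun p => Polynomial.coeff p k) hcomb
    simpa only [coeff_C_mul, hk1, hk2, mul_one, mul_zero] using this
  have e2 : Complex.I * βk ω₀ * (αk ω₀ - αkm1 ω₀) - deriv βk ω₀ = 0 := by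
    have := congrArg (fun p => Polynomial.coeff p (k - 1)) hcomb
    simp only [coeff_C_mul, e1, hk3, mul_one, zero_mul] at this
    exact this.symm
  have hI := Complex.I_mul_I
  constructor
  · linear_combination Complex.I * e1 + (βkp1 ω₀ - βk ω₀) * hI
  · field_simp
    linear_combination Complex.I * e2 - βk ω₀ * (αk ω₀ - αkm1 ω₀) * hI
end

section
/- Let n ≥ 1, let x_1,…,x_n : ℝ → ℂ be functions differentiable at ω* ∈ ℝ, and set p(ω) = ∏_{j=1}^{n} (X − x_j(ω)) ∈ ℂ[X]. Assume that for every ω in a neighborhood of ω*, ∫_{−1}^{1} p(ω)(x)·x^k·e^{iωx} dx = 0 for every k = 0,…,n−1. If x_j′(ω*) = 0 for all j = 1,…,n, then ∫_{−1}^{1} p(ω*)(x)²·e^{iω*x} dx = 0. -/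
open Polynomial MeasureTheory

noncomputable def auxM (m : ℕ) (ω : ℝ) : ℂ :=
  ∫ t in (-1 : ℝ)..1, (t : ℂ) ^ m * Complex.exp (Complex.I * ω * t)

theorem auxM_hasDerivAt (m : ℕ) (ω : ℝ) :
    HasDerivAt (auxM m) (Complex.I * auxM (m + 1) ω) ω := by
  have h := (intervalIntegral.hasDerivAt_integral_of_dominated_loc_of_deriv_le
    (μ := volume) (a := (-1 : ℝ)) (b := 1) (s := Set.univ) (x₀ := ω)
    (F := fun (w t : ℝ) => (t : ℂ) ^ m * Complex.exp (Complex.I * w * t))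
    (F' := fun (w t : ℝ) => Complex.I * ((t : ℂ) ^ (m + 1) * Complex.exp (Complex.I * w * t)))
    (bound := fun _ => 1) Filter.univ_mem ?_ ?_ ?_ ?_ ?_ ?_).2
  · rw [intervalIntegral.integral_const_mul] at h
    exact h
  · exact Filter.Eventually.of_forall fun w =>
      (Continuous.aestronglyMeasurable (by fun_prop))
  · exact Continuous.intervalIntegrable (by fun_prop) _ _
  · exact Continuous.aestronglyMeasurable (by fun_prop)
  · refine Filter.Eventually.of_forall fun t ht w _ => ?_
    rw [Set.uIoc_of_le (by norm_num)] at ht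
    have h1 : Complex.I * (w : ℂ) * t = ((w * t : ℝ) : ℂ) * Complex.I := by push_cast; ring
    rw [norm_mul, norm_mul, h1, Complex.norm_exp_ofReal_mul_I, norm_pow, Complex.norm_I,
      Complex.norm_real, one_mul, mul_one]
    exact pow_le_one₀ (norm_nonneg _) (abs_le.2 ⟨ht.1.le, ht.2⟩)
  · exact intervalIntegrable_const
  · refine Filter.Eventually.of_forall fun t _ w _ => ?_
    have h0 : HasDerivAt (fun w : ℝ => (w : ℂ)) 1 w := Complex.ofRealCLM.hasDerivAt
    have h1 := (((h0.const_mul Complex.I).mul_const (t : ℂ)).cexp).const_mul ((t : ℂ) ^ m)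
    have h2 : Complex.I * ((t : ℂ) ^ (m + 1) * Complex.exp (Complex.I * w * t)) =
      (t : ℂ) ^ m * (Complex.exp (Complex.I * w * t) * (Complex.I * 1 * t)) := by ring
    simp only [h2]
    exact h1

theorem aux_prod (n : ℕ) (y : Fin n → ℂ) (t : ℂ) :
    ∏ j, (t - y j) = ∑ s : Finset (Fin n), (∏ j ∈ s, (-y j)) * t ^ (sᶜ).card := by
  have : ∏ j, (t - y j) = ∏ j, (-y j + t) := by
    refine Finset.prod_congr rfl fun j _ => by ring
  rw [this, Fintype.prod_add]
  simp

theorem aux_int (n : ℕ) (y : Fin n → ℂ) (k : ℕ) (ω : ℝ) :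
    ∫ t in (-1 : ℝ)..1, (∏ j, ((t : ℂ) - y j)) * (t : ℂ) ^ k * Complex.exp (Complex.I * ω * t)
      = ∑ s : Finset (Fin n), (∏ j ∈ s, (-y j)) * auxM ((sᶜ).card + k) ω := by
  simp only [auxM, ← intervalIntegral.integral_const_mul]
  rw [← intervalIntegral.integral_finsetSum]
  · refine intervalIntegral.integral_congr fun t _ => ?_
    simp only [aux_prod, Finset.sum_mul]
    refine Finset.sum_congr rfl fun s _ => by ring
  · intro s _
    exact Continuous.intervalIntegrable (by fun_prop) _ _

theorem stationary_roots_imply_vanishing_norm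
    (n : ℕ) (hn : 1 ≤ n) (ωs : ℝ) (x : Fin n → ℝ → ℂ)
    (hdiff : ∀ j, DifferentiableAt ℝ (x j) ωs)
    (horth : ∀ᶠ ω in nhds ωs, ∀ k < n, ∫ t in (-1 : ℝ)..1,
      (∏ j, ((t : ℂ) - x j ω)) * (t : ℂ) ^ k * Complex.exp (Complex.I * ω * t) = 0)
    (hstat : ∀ j, deriv (x j) ωs = 0) :
    ∫ t in (-1 : ℝ)..1,
      (∏ j, ((t : ℂ) - x j ωs)) ^ 2 * Complex.exp (Complex.I * ωs * t) = 0 := by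
  have hx : ∀ j, HasDerivAt (x j) 0 ωs := fun j => hstat j ▸ (hdiff j).hasDerivAt
  have hc : ∀ s : Finset (Fin n), HasDerivAt (fun ω => ∏ j ∈ s, (-x j ω)) 0 ωs := by
    intro s
    induction s using Finset.induction_on with
    | empty => simpa using hasDerivAt_const ωs (1 : ℂ)
    | insert a s ha ih =>
      simp only [Finset.prod_insert ha]
      simpa using (hx a).fun_neg.fun_mul ih
  have hle : ∀ k ≤ n, ∫ t in (-1 : ℝ)..1,
      (∏ j, ((t : ℂ) - x j ωs)) * (t : ℂ) ^ k * Complex.exp (Complex.I * ωs * t) = 0 := by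
    intro k hk
    rcases hk.lt_or_eq with h | rfl
    · exact horth.self_of_nhds k h
    obtain ⟨m, rfl⟩ : ∃ m, k = m + 1 := ⟨k - 1, by omega⟩
    have hd := HasDerivAt.fun_sum (u := Finset.univ) fun s (_ : s ∈ Finset.univ) =>
      (hc s).fun_mul (auxM_hasDerivAt ((sᶜ).card + m) ωs)
    have h0 := hd.unique ((hasDerivAt_const ωs (0 : ℂ)).congr_of_eventuallyEq (by
      filter_upwards [horth] with ω hω
      rw [← hω m (by omega), aux_int]))
    rw [aux_int]
    have h1 : Complex.I * ∑ s : Finset (Fin (m + 1)),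
        (∏ j ∈ s, (-x j ωs)) * auxM ((sᶜ).card + (m + 1)) ωs = 0 := by
      rw [← h0, Finset.mul_sum]
      refine Finset.sum_congr rfl fun s _ => ?_
      rw [← add_assoc]; ring
    exact (mul_eq_zero.1 h1).resolve_left Complex.I_ne_zero
  have key : ∀ t : ℝ, (∏ j, ((t : ℂ) - x j ωs)) ^ 2 * Complex.exp (Complex.I * ωs * t)
      = ∑ s : Finset (Fin n), (∏ j ∈ s, (-x j ωs)) *
        ((∏ j, ((t : ℂ) - x j ωs)) * (t : ℂ) ^ (sᶜ).card * Complex.exp (Complex.I * ωs * t)) := by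
    intro t
    rw [pow_two]
    nth_rewrite 1 [aux_prod]
    rw [Finset.sum_mul, Finset.sum_mul]
    refine Finset.sum_congr rfl fun s _ => by ring
  simp only [key]
  rw [intervalIntegral.integral_finsetSum]
  · refine Finset.sum_eq_zero fun s _ => ?_
    rw [intervalIntegral.integral_const_mul, hle _ (by simpa using Finset.card_le_univ sᶜ),
      mul_zero]
  · intro s _
    exact Continuous.intervalIntegrable (by fun_prop) _ _
end

section
/- Let n ≥ 1, let x_1,…,x_n : ℝ → ℂ be functions differentiable at ω* ∈ ℝ with x_1(ω*),…,x_n(ω*) pairwise distinct, and set p(ω) = ∏_{j=1}^{n} (X − x_j(ω)) ∈ ℂ[X]. Assume that for every ω in a neighborhood of ω*, ∫_{−1}^{1} p(ω)(x)·x^k·e^{iωx} dx = 0 for every k = 0,…,n−1, and that p(ω*) is the unique monic polynomial of degree n satisfying these orthogonality conditions at ω*. If ∫_{−1}^{1} p(ω*)(x)²·e^{iω*x} dx = 0, then x_j′(ω*) = 0 for all j = 1,…,n. -/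
open Polynomial MeasureTheory

noncomputable def momL (ω : ℝ) : ℂ[X] →ₗ[ℂ] ℂ where
  toFun P := ∫ t in (-1 : ℝ)..1, P.eval (t : ℂ) * Complex.exp (Complex.I * ω * t)
  map_add' P Q := by
    rw [← intervalIntegral.integral_add]
    · congr 1; ext t; simp [add_mul]
    · apply Continuous.intervalIntegrable
      have := P.continuous
      fun_prop
    · apply Continuous.intervalIntegrable
      have := Q.continuous
      fun_prop
  map_smul' c P := by
    rw [RingHom.id_apply, smul_eq_mul, ← intervalIntegral.integral_const_mul]
    congr 1; ext t; simp [mul_assoc]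

theorem momL_apply (ω : ℝ) (P : ℂ[X]) : momL ω P =
  ∫ t in (-1 : ℝ)..1, P.eval (t : ℂ) * Complex.exp (Complex.I * ω * t) := rfl

theorem momL_deriv (ω : ℝ) (m : ℕ) :
    HasDerivAt (fun w : ℝ => momL w (X ^ m)) (Complex.I * momL ω (X ^ (m+1))) ω := by
  rw [momL_apply, ← intervalIntegral.integral_const_mul]
  simp only [momL_apply]
  refine (intervalIntegral.hasDerivAt_integral_of_dominated_loc_of_deriv_le (μ := volume)
    (F := fun (w : ℝ) (t : ℝ) => (X ^ m : ℂ[X]).eval (t : ℂ) * Complex.exp (Complex.I * w * t))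
    (F' := fun (w : ℝ) (t : ℝ) => Complex.I * ((X ^ (m+1) : ℂ[X]).eval (t : ℂ) * Complex.exp (Complex.I * w * t)))
    (s := Set.univ) (bound := fun _ => 1) Filter.univ_mem ?_ ?_ ?_ ?_ ?_ ?_).2
  · refine Filter.Eventually.of_forall fun w => Continuous.aestronglyMeasurable ?_
    simp only [eval_pow, eval_X]; fun_prop
  · apply Continuous.intervalIntegrable
    simp only [eval_pow, eval_X]; fun_prop
  · refine Continuous.aestronglyMeasurable ?_
    simp only [eval_pow, eval_X]; fun_prop
  · refine Filter.Eventually.of_forall fun t ht w _ => ?_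
    rw [Set.uIoc_of_le (by norm_num)] at ht
    have h1 : ‖Complex.exp (Complex.I * w * t)‖ = 1 := by
      rw [Complex.norm_exp]; simp
    simp only [eval_pow, eval_X, norm_mul, norm_pow, h1, Complex.norm_I, Complex.norm_real,
      one_mul, mul_one]
    exact pow_le_one₀ (norm_nonneg _) (abs_le.2 ⟨ht.1.le, ht.2⟩)
  · exact intervalIntegrable_const
  · refine Filter.Eventually.of_forall fun t ht w _ => ?_
    have h0 : HasDerivAt (fun w : ℝ => Complex.I * (w : ℂ) * t) (Complex.I * 1 * t) w :=
      ((Complex.ofRealCLM.hasDerivAt (x := w)).const_mul Complex.I).mul_const _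
    have := (h0.cexp).const_mul ((X ^ m : ℂ[X]).eval (t : ℂ))
    refine this.congr_deriv ?_
    simp only [eval_pow, eval_X, Complex.ofRealCLM_apply]; ring

theorem coeff_diff {ι : Type*} (s : Finset ι) (x : ι → ℝ → ℂ) (ω : ℝ)
    (h : ∀ j, DifferentiableAt ℝ (x j) ω) :
    ∀ m, DifferentiableAt ℝ (fun w => (∏ j ∈ s, (X - C (x j w))).coeff m) ω := by
  classical
  induction s using Finset.induction_on with
  | empty => intro m; simp
  | insert a s ha ih =>
    intro m
    simp only [Finset.prod_insert ha, sub_mul, coeff_sub, coeff_C_mul]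
    refine DifferentiableAt.sub ?_ ((h a).mul (ih m))
    cases m with
    | zero => simp
    | succ m => simpa using ih m

theorem momL_expand (ω : ℝ) (P R : ℂ[X]) (N : ℕ) (h : P.natDegree < N) :
    momL ω (P * R) = ∑ m ∈ Finset.range N, P.coeff m * momL ω (X ^ m * R) := by
  conv_lhs => rw [P.as_sum_range' N h]
  simp only [Finset.sum_mul, map_sum, ← C_mul_X_pow_eq_monomial, ← smul_eq_C_mul, smul_mul_assoc, map_smul, smul_eq_mul]

theorem vanishing_norm_implies_stationary_roots
    (n : ℕ) (hn : 1 ≤ n) (ωs : ℝ) (x : Fin n → ℝ → ℂ)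
    (hdiff : ∀ j, DifferentiableAt ℝ (x j) ωs)
    (hdistinct : ∀ i j : Fin n, i ≠ j → x i ωs ≠ x j ωs)
    (horth : ∀ᶠ ω in nhds ωs, ∀ k < n, ∫ t in (-1 : ℝ)..1,
      (∏ j, ((t : ℂ) - x j ω)) * (t : ℂ) ^ k * Complex.exp (Complex.I * ω * t) = 0)
    (huniq : ∀ q : Polynomial ℂ, q.Monic → q.natDegree = n →
      (∀ k < n, ∫ t in (-1 : ℝ)..1,
        q.eval (t : ℂ) * (t : ℂ) ^ k * Complex.exp (Complex.I * ωs * t) = 0) →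
      q = ∏ j, (X - Polynomial.C (x j ωs)))
    (hnorm : ∫ t in (-1 : ℝ)..1,
      (∏ j, ((t : ℂ) - x j ωs)) ^ 2 * Complex.exp (Complex.I * ωs * t) = 0) :
    ∀ j, deriv (x j) ωs = 0 := by
  classical
  set P : ℝ → ℂ[X] := fun w => ∏ j, (X - C (x j w)) with hP
  have hmon : ∀ w, (P w).Monic := fun w => monic_prod_of_monic _ _ fun j _ => monic_X_sub_C _
  have hdeg : ∀ w, (P w).natDegree = n := fun w => by
    simp only [hP]
    rw [natDegree_prod_of_monic Finset.univ (fun j => X - C (x j w)) (fun j _ => monic_X_sub_C (x j w))]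
    simp
  have hev : ∀ w z, (P w).eval z = ∏ j, (z - x j w) := fun w z => by simp [hP, eval_prod]
  have horth' : ∀ᶠ w in nhds ωs, ∀ k < n, momL w (P w * X ^ k) = 0 := by
    filter_upwards [horth] with w hw k hk
    simpa [momL_apply, hev] using hw k hk
  have h0 := horth'.self_of_nhds
  have hnorm' : momL ωs (P ωs * P ωs) = 0 := by
    simpa [momL_apply, hev, ← pow_two] using hnorm
  have hlow : ∀ R : ℂ[X], R.degree < n → momL ωs (P ωs * R) = 0 := by
    intro R hR
    rw [mul_comm, momL_expand ωs R (P ωs) n]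
    · refine Finset.sum_eq_zero fun m hm => ?_
      rw [mul_comm (X ^ m), h0 m (Finset.mem_range.1 hm), mul_zero]
    · by_cases hR0 : R = 0
      · simp [hR0]; omega
      · exact (natDegree_lt_iff_degree_lt hR0).2 hR
  have hXn : momL ωs (P ωs * X ^ n) = 0 := by
    have : P ωs * X ^ n = P ωs * (X ^ n - P ωs) + P ωs * P ωs := by ring
    rw [this, map_add, hnorm', add_zero]
    apply hlow
    have h1 : (X ^ n : ℂ[X]).degree = (n : WithBot ℕ) := degree_X_pow n
    rw [← h1]
    apply degree_sub_lt
    · rw [h1, degree_eq_natDegree (hmon ωs).ne_zero, hdeg]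
    · exact pow_ne_zero _ X_ne_zero
    · rw [(hmon ωs).leadingCoeff, (monic_X_pow n).leadingCoeff]
  have hshift : ∀ k < n, momL ωs (P ωs * X ^ (k + 1)) = 0 := by
    intro k hk
    rcases Nat.lt_or_ge (k + 1) n with h | h
    · exact h0 _ h
    · obtain rfl : n = k + 1 := by omega
      exact hXn
  set c : ℕ → ℂ := fun m => deriv (fun w => (P w).coeff m) ωs with hc
  have hcd : ∀ m, HasDerivAt (fun w => (P w).coeff m) (c m) ωs := fun m =>
    (coeff_diff Finset.univ x ωs hdiff m).hasDerivAt
  have hcn : c n = 0 := by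
    have : (fun w => (P w).coeff n) = fun _ => (1 : ℂ) := by
      funext w
      have := (hmon w).coeff_natDegree
      rwa [hdeg] at this
    simp [hc, this]
  set Q : ℂ[X] := ∑ m ∈ Finset.range n, C (c m) * X ^ m with hQ
  have hQ' : Q = ∑ m ∈ Finset.range (n+1), C (c m) * X ^ m := by
    rw [Finset.sum_range_succ, hcn]; simp [hQ]
  have hQdeg : Q.degree < n := by
    rw [hQ]
    exact degree_sum_fin_lt (fun i : Fin n => c i) |> fun h => by
      rwa [Fin.sum_univ_eq_sum_range (fun m => C (c m) * X ^ m)] at h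
  have hQorth : ∀ k < n, momL ωs (Q * X ^ k) = 0 := by
    intro k hk
    have hd : HasDerivAt (fun w => ∑ m ∈ Finset.range (n+1), (P w).coeff m * momL w (X ^ (m + k)))
        (∑ m ∈ Finset.range (n+1), (c m * momL ωs (X ^ (m+k)) +
          (P ωs).coeff m * (Complex.I * momL ωs (X ^ (m+k+1))))) ωs := by
      apply HasDerivAt.fun_sum
      intro m _
      exact (hcd m).mul (momL_deriv ωs (m+k))
    have hz : (fun w => ∑ m ∈ Finset.range (n+1), (P w).coeff m * momL w (X ^ (m + k)))
        =ᶠ[nhds ωs] fun _ => 0 := by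
      filter_upwards [horth'] with w hw
      rw [← hw k hk, momL_expand w (P w) _ (n+1) (by rw [hdeg]; omega)]
      simp only [pow_add]
    have he := hd.unique ((hasDerivAt_const ωs (0:ℂ)).congr_of_eventuallyEq hz)
    rw [Finset.sum_add_distrib] at he
    have h2 : ∑ m ∈ Finset.range (n+1), (P ωs).coeff m * (Complex.I * momL ωs (X ^ (m+k+1))) = 0 := by
      have := hshift k hk
      rw [momL_expand ωs (P ωs) _ (n+1) (by rw [hdeg]; omega)] at this
      rw [← mul_zero Complex.I, ← this, Finset.mul_sum]
      refine Finset.sum_congr rfl fun m _ => ?_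
      rw [← pow_add, ← add_assoc]; ring
    rw [h2, add_zero] at he
    rw [← he, hQ']
    simp only [Finset.sum_mul, map_sum, mul_assoc, ← smul_eq_C_mul, map_smul, smul_eq_mul, smul_mul_assoc, pow_add]
  have hdP : (P ωs).degree = n := by rw [degree_eq_natDegree (hmon ωs).ne_zero, hdeg]
  have hQ0 : Q = 0 := by
    have := huniq (P ωs + Q) ((hmon ωs).add_of_left (by rwa [hdP]))
      (by rw [natDegree_add_eq_left_of_degree_lt (by rwa [hdP]), hdeg]) (by
        intro k hk
        have : momL ωs ((P ωs + Q) * X ^ k) = 0 := by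
          rw [add_mul, map_add, h0 k hk, hQorth k hk, add_zero]
        simpa [momL_apply] using this)
    exact add_eq_left.1 this
  intro j
  have hd1 : HasDerivAt (fun w => (P w).eval (x j ωs)) (Q.eval (x j ωs)) ωs := by
    have hs : (fun w => (P w).eval (x j ωs)) =
        fun w => ∑ m ∈ Finset.range (n+1), (P w).coeff m * (x j ωs) ^ m := by
      funext w
      rw [eval_eq_sum_range' (n := n+1) (by rw [hdeg]; omega)]
    rw [hs, hQ', eval_finset_sum]
    apply HasDerivAt.fun_sum
    intro m _
    simpa using (hcd m).mul_const ((x j ωs) ^ m)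
  have hg : DifferentiableAt ℝ (fun w => ∏ i ∈ Finset.univ.erase j, (x j ωs - x i w)) ωs :=
    DifferentiableAt.fun_finset_prod fun i _ => (differentiableAt_const _).sub (hdiff i)
  have hd2 := ((hasDerivAt_const ωs (x j ωs)).sub (hdiff j).hasDerivAt).mul hg.hasDerivAt
  have hfe : (fun w => (P w).eval (x j ωs)) =
      fun w => (x j ωs - x j w) * ∏ i ∈ Finset.univ.erase j, (x j ωs - x i w) := by
    funext w
    rw [hev, Finset.mul_prod_erase Finset.univ (fun i => x j ωs - x i w) (Finset.mem_univ j)]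
  rw [hfe, hQ0] at hd1
  have := hd1.unique hd2
  simp only [eval_zero, Pi.sub_apply, sub_self, zero_mul, add_zero, zero_sub] at this
  rcases mul_eq_zero.1 this.symm with h | h
  · simpa using h
  · obtain ⟨i, hi, h⟩ := Finset.prod_eq_zero_iff.1 h
    exact absurd (sub_eq_zero.1 h) (hdistinct j i (Finset.ne_of_mem_erase hi).symm)
end

section
/- Let ω ∈ ℝ, n ≥ 1, and let p ∈ ℂ[X] be a monic polynomial of degree n with ∫_{−1}^{1} p(x)·x^k·e^{iωx} dx = 0 for every k = 0,…,n−1, and assume additionally that ∫_{−1}^{1} p(x)²·e^{iωx} dx = 0. Then ∫_{−1}^{1} p(x)·x^n·e^{iωx} dx = 0 (p satisfies all orthogonality conditions required of the degree-(n+1) orthogonal polynomial); consequently, for every monic polynomial q ∈ ℂ[X] of degree n+1 with ∫_{−1}^{1} q(x)·x^k·e^{iωx} dx = 0 for all k = 0,…,n, the polynomial q + p is a monic polynomial of degree n+1 distinct from q satisfying the same n+1 orthogonality conditions; in particular the monic orthogonal polynomial of degree n+1 is not unique. -/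
open Polynomial MeasureTheory

theorem vanishing_norm_implies_nonuniqueness_next_degree
    (ω : ℝ) (n : ℕ) (hn : 1 ≤ n)
    (p : Polynomial ℂ) (hmonic : p.Monic) (hdeg : p.natDegree = n)
    (horth : ∀ k < n, ∫ x in (-1 : ℝ)..1,
      p.eval (x : ℂ) * (x : ℂ) ^ k * Complex.exp (Complex.I * ω * x) = 0)
    (hpp : ∫ x in (-1 : ℝ)..1,
      (p.eval (x : ℂ)) ^ 2 * Complex.exp (Complex.I * ω * x) = 0) :
    (∫ x in (-1 : ℝ)..1,
      p.eval (x : ℂ) * (x : ℂ) ^ n * Complex.exp (Complex.I * ω * x) = 0) ∧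
    ∀ q : Polynomial ℂ, q.Monic → q.natDegree = n + 1 →
      (∀ k < n + 1, ∫ x in (-1 : ℝ)..1,
        q.eval (x : ℂ) * (x : ℂ) ^ k * Complex.exp (Complex.I * ω * x) = 0) →
      ((q + p).Monic ∧ (q + p).natDegree = n + 1 ∧ q + p ≠ q ∧
        ∀ k < n + 1, ∫ x in (-1 : ℝ)..1,
          (q + p).eval (x : ℂ) * (x : ℂ) ^ k * Complex.exp (Complex.I * ω * x) = 0) := by
  have hint : ∀ (r : Polynomial ℂ) (k : ℕ), IntervalIntegrable (fun x : ℝ =>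
      r.eval (x : ℂ) * (x : ℂ) ^ k * Complex.exp (Complex.I * ω * x)) volume (-1) 1 := by
    intro r k
    apply Continuous.intervalIntegrable
    have h1 : Continuous (fun x : ℝ => r.eval (x : ℂ)) :=
      r.continuous.comp Complex.continuous_ofReal
    fun_prop
  have hmain : ∫ x in (-1 : ℝ)..1,
      p.eval (x : ℂ) * (x : ℂ) ^ n * Complex.exp (Complex.I * ω * x) = 0 := by
    have e : ∀ x : ℝ, (p.eval (x : ℂ)) ^ 2 * Complex.exp (Complex.I * ω * x) =
        ∑ k ∈ Finset.range (n + 1), p.coeff k *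
          (p.eval (x : ℂ) * (x : ℂ) ^ k * Complex.exp (Complex.I * ω * x)) := by
      intro x
      have h2 : p.eval (x : ℂ) = ∑ k ∈ Finset.range (n + 1), p.coeff k * (x : ℂ) ^ k := by
        rw [← hdeg]; exact Polynomial.eval_eq_sum_range _
      calc _ = p.eval (x : ℂ) * (∑ k ∈ Finset.range (n + 1), p.coeff k * (x : ℂ) ^ k) *
            Complex.exp (Complex.I * ω * x) := by rw [← h2]; ring
        _ = _ := by
          rw [Finset.mul_sum, Finset.sum_mul]
          exact Finset.sum_congr rfl fun k _ => by ring
    simp_rw [e] at hpp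
    rw [intervalIntegral.integral_finsetSum (fun k _ => (hint p k).const_mul _)] at hpp
    simp_rw [intervalIntegral.integral_const_mul] at hpp
    rw [Finset.sum_range_succ, Finset.sum_eq_zero (fun k hk => by
      rw [horth k (Finset.mem_range.mp hk), mul_zero])] at hpp
    have hc : p.coeff n = 1 := by rw [← hdeg]; exact hmonic
    simpa [hc] using hpp
  refine ⟨hmain, fun q hq hqd hqo => ?_⟩
  have hlt : p.degree < q.degree :=
    Polynomial.degree_lt_degree (by omega)
  refine ⟨hq.add_of_left hlt, ?_, ?_, ?_⟩
  · rw [Polynomial.natDegree_add_eq_left_of_degree_lt hlt, hqd]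
  · intro h
    exact hmonic.ne_zero (by simpa using h)
  · intro k hk
    have hp0 : ∫ x in (-1 : ℝ)..1,
        p.eval (x : ℂ) * (x : ℂ) ^ k * Complex.exp (Complex.I * ω * x) = 0 := by
      rcases Nat.lt_succ_iff_lt_or_eq.mp hk with h | h
      · exact horth k h
      · rw [h]; exact hmain
    simp_rw [Polynomial.eval_add, add_mul]
    rw [intervalIntegral.integral_add (hint q k) (hint p k), hqo k hk, hp0, add_zero]
end

section
/- Let n ≥ 1 and N be integers with N ≥ 2n, and set M = ⌊N/2⌋. Let Ω > 0, and for each ω ≥ Ω let x_1(ω),…,x_{2n}(ω) ∈ ℂ and w_1(ω),…,w_{2n}(ω) ∈ ℂ be such that: (a) exactness holds, Σ_{j=1}^{2n} w_j(ω)·x_j(ω)^k = ∫_{−1}^{1} x^k·e^{iωx} dx for every k = 0,…,N−1; (b) there is a constant B such that ω·|x_j(ω)+1| ≤ B for j = 1,…,n and ω·|x_j(ω)−1| ≤ B for j = n+1,…,2n, for all ω ≥ Ω; (c) there is a constant c > 0 such that |x_i(ω) − x_j(ω)| ≥ c/ω for all i ≠ j and all ω ≥ Ω. Then for every entire function f :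 ℂ → ℂ there exists C such that |Σ_{j=1}^{2n} w_j(ω)·f(x_j(ω)) − ∫_{−1}^{1} f(x)·e^{iωx} dx| ≤ C·ω^{−M−1} for all ω ≥ Ω; that is, the quadrature error is O(ω^{−M−1}) as ω → ∞. -/
open MeasureTheory

noncomputable def oscJ (F : ℂ → ℂ) (ω : ℝ) : ℂ :=
  ∫ t in (-1 : ℝ)..1, F (t : ℂ) * Complex.exp (Complex.I * ω * t)

lemma oscJ_integrable (F : ℂ → ℂ) (hF : Continuous F) (ω : ℝ) :
    IntervalIntegrable (fun t : ℝ => F (t : ℂ) * Complex.exp (Complex.I * ω * t)) volume (-1) 1 := by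
  apply Continuous.intervalIntegrable
  fun_prop

lemma oscJ_add (F G : ℂ → ℂ) (hF : Continuous F) (hG : Continuous G) (ω : ℝ) :
    oscJ (fun z => F z + G z) ω = oscJ F ω + oscJ G ω := by
  unfold oscJ
  rw [← intervalIntegral.integral_add (oscJ_integrable F hF ω) (oscJ_integrable G hG ω)]
  congr 1; ext t; ring

lemma oscJ_smul (F : ℂ → ℂ) (a : ℂ) (ω : ℝ) :
    oscJ (fun z => a * F z) ω = a * oscJ F ω := by
  unfold oscJ
  rw [← intervalIntegral.integral_const_mul]
  congr 1; ext t; ring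

lemma oscJ_parts (F F' : ℂ → ℂ) (hF : ∀ z, HasDerivAt F (F' z) z) (hF' : Continuous F') (ω : ℝ)
    (hω : 0 < ω) :
    oscJ F ω = (F 1 * Complex.exp (Complex.I * ω) - F (-1) * Complex.exp (-(Complex.I * ω)))
        / (Complex.I * ω) - oscJ F' ω / (Complex.I * ω) := by
  have hc : Complex.I * (ω : ℂ) ≠ 0 :=
    mul_ne_zero Complex.I_ne_zero (by exact_mod_cast hω.ne')
  have h1 : ∀ t ∈ Set.uIcc (-1 : ℝ) 1, HasDerivAt (fun t : ℝ => F (t : ℂ)) (F' (t : ℂ)) t :=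
    fun t _ => (hF t).comp_ofReal
  have h2 : ∀ t ∈ Set.uIcc (-1 : ℝ) 1,
      HasDerivAt (fun t : ℝ => Complex.exp (Complex.I * ω * t) / (Complex.I * ω))
        (Complex.exp (Complex.I * ω * t)) t := by
    intro t _
    have h0 : HasDerivAt (fun z : ℂ => Complex.exp (Complex.I * ω * z) / (Complex.I * ω))
        (Complex.exp (Complex.I * ω * t)) (t : ℂ) := by
      have := (((hasDerivAt_id (t : ℂ)).const_mul (Complex.I * ω)).cexp).div_const (Complex.I * ω)
      refine this.congr_deriv ?_
      rw [mul_one, mul_div_assoc, div_self hc, mul_one]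
      rfl
    exact h0.comp_ofReal
  have h3 := intervalIntegral.integral_mul_deriv_eq_deriv_mul h1 h2
    (by apply Continuous.intervalIntegrable; fun_prop)
    (by apply Continuous.intervalIntegrable; fun_prop)
  unfold oscJ
  rw [h3, ← intervalIntegral.integral_div]
  congr 1
  · push_cast
    simp only [mul_one, mul_neg]
    ring
  · congr 1; ext t; ring

lemma oscJ_bdd (F : ℂ → ℂ) (hF : Continuous F) : ∃ C : ℝ, 0 ≤ C ∧ ∀ ω : ℝ, ‖oscJ F ω‖ ≤ C := by
  obtain ⟨C, hC⟩ := (isCompact_closedBall (0 : ℂ) 1).exists_bound_of_continuousOn hF.continuousOn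
  refine ⟨|C| * |1 - (-1)|, by positivity, fun ω => ?_⟩
  apply intervalIntegral.norm_integral_le_of_norm_le_const
  intro t ht
  rw [Set.uIoc_of_le (by norm_num)] at ht
  have h1 : ‖Complex.exp (Complex.I * ω * t)‖ = 1 := by
    rw [show Complex.I * ω * t = ((ω * t : ℝ) : ℂ) * Complex.I by push_cast; ring]
    exact Complex.norm_exp_ofReal_mul_I _
  rw [norm_mul, h1, mul_one]
  refine (hC _ ?_).trans (le_abs_self _)
  simp only [mem_closedBall_zero_iff, Complex.norm_real, Real.norm_eq_abs]
  exact abs_le.2 ⟨ht.1.le, ht.2⟩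

lemma entire_deriv (h : ℂ → ℂ) (hh : Differentiable ℂ h) : Differentiable ℂ (deriv h) := by
  rw [← differentiableOn_univ] at hh ⊢
  exact hh.deriv isOpen_univ

lemma norm_exp_I (ω : ℝ) : ‖Complex.exp (Complex.I * ω)‖ = 1 := by
  rw [mul_comm]; exact Complex.norm_exp_ofReal_mul_I _

lemma norm_exp_neg_I (ω : ℝ) : ‖Complex.exp (-(Complex.I * ω))‖ = 1 := by
  rw [Complex.exp_neg, norm_inv, norm_exp_I, inv_one]

lemma oscJ_decay (m : ℕ) : ∀ (h : ℂ → ℂ), Differentiable ℂ h → ∃ C : ℝ, 0 ≤ C ∧ ∀ ω : ℝ, 0 < ω →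
    ‖oscJ (fun z => (z ^ 2 - 1) ^ m * h z) ω‖ ≤ C / ω ^ (m + 1) := by
  induction m with
  | zero =>
    intro h hh
    have hd := (entire_deriv h hh).continuous
    obtain ⟨C, hC0, hC⟩ := oscJ_bdd _ hd
    refine ⟨‖h 1‖ + ‖h (-1)‖ + C, by positivity, fun ω hω => ?_⟩
    simp only [pow_zero, one_mul, zero_add, pow_one]
    rw [oscJ_parts h (deriv h) (fun z => (hh z).hasDerivAt) hd ω hω, ← sub_div, norm_div]
    have : ‖Complex.I * (ω : ℂ)‖ = ω := by simp [abs_of_pos hω]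
    rw [this]
    gcongr
    refine (norm_sub_le _ _).trans (add_le_add ((norm_sub_le _ _).trans ?_) (hC ω))
    rw [norm_mul, norm_mul, norm_exp_I, norm_exp_neg_I, mul_one, mul_one]
  | succ m ih =>
    intro h hh
    have hd := entire_deriv h hh
    obtain ⟨C, hC0, hC⟩ := ih (fun z => 2 * (m + 1) * z * h z + (z ^ 2 - 1) * deriv h z)
      (by fun_prop)
    refine ⟨C, hC0, fun ω hω => ?_⟩
    have hD : ∀ z : ℂ, HasDerivAt (fun z => (z ^ 2 - 1) ^ (m + 1) * h z)
        ((z ^ 2 - 1) ^ m * (2 * (m + 1) * z * h z + (z ^ 2 - 1) * deriv h z)) z := by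
      intro z
      have h1 : HasDerivAt (fun z : ℂ => (z ^ 2 - 1)) (2 * z) z := by
        simpa using ((hasDerivAt_id z).pow 2).sub_const 1
      have := (h1.pow (m + 1)).mul (hh z).hasDerivAt
      refine this.congr_deriv ?_
      rw [Nat.add_sub_cancel]
      push_cast
      simp only [Pi.pow_apply]
      ring
    have hdc := hd.continuous
    have hhc := hh.continuous
    rw [oscJ_parts _ _ hD (by fun_prop) ω hω, ← sub_div, norm_div]
    have : ‖Complex.I * (ω : ℂ)‖ = ω := by simp [abs_of_pos hω]
    rw [this]
    have h3 := hC ω hω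
    have h4 : C / ω ^ (m + 1 + 1) = (C / ω ^ (m + 1)) / ω := by
      rw [div_div, ← pow_succ]
    rw [h4]
    gcongr
    simpa using h3

lemma hermite_split (f : ℂ → ℂ) (hf : Differentiable ℂ f) (M : ℕ) :
    ∃ (p : Polynomial ℂ) (g : ℂ → ℂ), Differentiable ℂ g ∧ p.degree < (2 * M : ℕ) ∧
      ∀ z, f z = p.eval z + (z ^ 2 - 1) ^ M * g z := by
  have key : ∀ (h : ℂ → ℂ) (a : ℂ), Differentiable ℂ h → Differentiable ℂ (dslope h a) := by
    intro h a hh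
    rw [← differentiableOn_univ] at hh ⊢
    exact (Complex.differentiableOn_dslope (by simp)).2 hh
  have key2 : ∀ (h : ℂ → ℂ) (a z : ℂ), h z = h a + (z - a) * dslope h a z := by
    intro h a z
    have := sub_smul_dslope h a z
    rw [smul_eq_mul] at this
    rw [this]; ring
  induction M with
  | zero => exact ⟨0, f, hf, by simp, by simp⟩
  | succ M ih =>
    obtain ⟨p, g, hg, hp, hfe⟩ := ih
    refine ⟨p + (Polynomial.X ^ 2 - 1) ^ M * (Polynomial.C (g 1) +
      (Polynomial.X - 1) * Polynomial.C (dslope g 1 (-1))), dslope (dslope g 1) (-1),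
      key _ _ (key _ _ hg), ?_, ?_⟩
    · refine (Polynomial.degree_add_le _ _).trans_lt (max_lt (hp.trans ?_) ?_)
      · exact_mod_cast (by omega)
      · have : ((Polynomial.X ^ 2 - 1) ^ M * (Polynomial.C (g 1) +
          (Polynomial.X - 1) * Polynomial.C (dslope g 1 (-1))) : Polynomial ℂ).degree
            ≤ ((M * 2 + 1 : ℕ) : WithBot ℕ) := by
          compute_degree
          exact le_of_eq (by push_cast; rfl)
        refine this.trans_lt ?_
        exact_mod_cast (by omega)
    · intro z
      rw [hfe z]
      simp only [Polynomial.eval_add, Polynomial.eval_mul, Polynomial.eval_pow, Polynomial.eval_sub,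
        Polynomial.eval_X, Polynomial.eval_one, Polynomial.eval_C]
      have h1 := key2 g 1 z
      have h2 := key2 (dslope g 1) (-1) z
      rw [h1, h2]; ring

lemma oscJ_cluster {ι : Type*} [DecidableEq ι] (B Ω : ℝ) (hB : 0 ≤ B) (hΩ : 0 < Ω)
    (L : Finset ι) : ∀ (R : Finset ι) (p q m : ℕ), m ≤ L.card + p → m ≤ R.card + q →
    ∃ C : ℝ, 0 ≤ C ∧ ∀ ω ≥ Ω, ∀ u : ι → ℂ, (∀ i ∈ L, ω * ‖u i + 1‖ ≤ B) →
      (∀ i ∈ R, ω * ‖u i - 1‖ ≤ B) →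
      ‖oscJ (fun z => (∏ i ∈ L, (z - u i)) * ((∏ i ∈ R, (z - u i)) * ((z + 1) ^ p * (z - 1) ^ q))) ω‖
        ≤ C / ω ^ (m + 1) := by
  have step : ∀ (m : ℕ) (C1 C2 ω : ℝ) (a : ℂ) (F G H : ℂ → ℂ), Continuous F → Continuous G →
      Ω ≤ ω → 0 ≤ C2 → ω * ‖a‖ ≤ B → (∀ z, H z = F z + (-a) * G z) →
      ‖oscJ F ω‖ ≤ C1 / ω ^ (m + 1) → ‖oscJ G ω‖ ≤ C2 / ω ^ (m - 1 + 1) →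
      ‖oscJ H ω‖ ≤ (C1 + B * C2 * (1 + 1 / Ω)) / ω ^ (m + 1) := by
    intro m C1 C2 ω a F G H hF hG hω hC2 ha hH h1 h2
    have hω0 : 0 < ω := hΩ.trans_le hω
    rw [funext hH, oscJ_add _ _ hF (by fun_prop), oscJ_smul, add_div]
    refine (norm_add_le _ _).trans (add_le_add h1 ?_)
    rw [norm_mul, norm_neg]
    have ha' : ‖a‖ ≤ B / ω := by rw [le_div_iff₀ hω0]; linarith
    calc ‖a‖ * ‖oscJ G ω‖ ≤ (B / ω) * (C2 / ω ^ (m - 1 + 1)) := by gcongr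
      _ ≤ _ := by
        have hBC : 0 ≤ B * C2 := mul_nonneg hB hC2
        rcases m with _ | m
        · have : 1 / ω ≤ 1 / Ω := by gcongr
          have e : B / ω * (C2 / ω ^ (0 - 1 + 1)) = (B * C2 * (1 / ω)) / ω ^ (0 + 1) := by
            simp only [zero_add, pow_one, Nat.zero_sub]
            field_simp
          rw [e]
          apply div_le_div_of_nonneg_right _ (by positivity)
          apply mul_le_mul_of_nonneg_left _ hBC
          linarith
        · simp only [Nat.add_sub_cancel]
          rw [div_mul_div_comm, ← pow_succ']
          apply div_le_div_of_nonneg_right _ (by positivity)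
          have : 0 ≤ B * C2 * (1 / Ω) := by positivity
          linarith
  induction L using Finset.induction_on with
  | empty =>
    intro R
    induction R using Finset.induction_on with
    | empty =>
      intro p q m hp hq
      simp only [Finset.card_empty, zero_add] at hp hq
      obtain ⟨C, hC0, hC⟩ := oscJ_decay m (fun z => (z + 1) ^ (p - m) * (z - 1) ^ (q - m))
        (by fun_prop)
      refine ⟨C, hC0, fun ω hω u _ _ => ?_⟩
      have := hC ω (hΩ.trans_le hω)
      convert this using 3
      ext z
      simp only [Finset.prod_empty, one_mul]
      rw [show (z ^ 2 - 1) = (z + 1) * (z - 1) by ring, mul_pow]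
      nth_rw 1 [← Nat.add_sub_cancel' hp, ← Nat.add_sub_cancel' hq]
      rw [pow_add, pow_add]; ring
    | insert a R ha ih =>
      intro p q m hp hq
      rw [Finset.card_insert_of_notMem ha] at hq
      obtain ⟨C1, h10, h1⟩ := ih p (q + 1) m hp (by omega)
      obtain ⟨C2, h20, h2⟩ := ih p q (m - 1) (by omega) (by omega)
      refine ⟨C1 + B * C2 * (1 + 1 / Ω), by positivity, fun ω hω u hL hR => ?_⟩
      have hR' : ∀ i ∈ R, ω * ‖u i - 1‖ ≤ B := fun i hi => hR i (Finset.mem_insert_of_mem hi)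
      refine step m C1 C2 ω (u a - 1) _ _ _ ?_ ?_ hω h20 (hR a (Finset.mem_insert_self _ _)) ?_
        (h1 ω hω u hL hR') (h2 ω hω u hL hR')
      · fun_prop
      · fun_prop
      · intro z
        rw [Finset.prod_insert ha]; ring
  | insert a L ha ih =>
    intro R p q m hp hq
    rw [Finset.card_insert_of_notMem ha] at hp
    obtain ⟨C1, h10, h1⟩ := ih R (p + 1) q m (by omega) (by omega)
    obtain ⟨C2, h20, h2⟩ := ih R p q (m - 1) (by omega) (by omega)
    refine ⟨C1 + B * C2 * (1 + 1 / Ω), by positivity, fun ω hω u hL hR => ?_⟩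
    have hL' : ∀ i ∈ L, ω * ‖u i + 1‖ ≤ B := fun i hi => hL i (Finset.mem_insert_of_mem hi)
    refine step m C1 C2 ω (u a + 1) _ _ _ ?_ ?_ hω h20 (hL a (Finset.mem_insert_self _ _)) ?_
        (h1 ω hω u hL' hR) (h2 ω hω u hL' hR)
    · fun_prop
    · fun_prop
    · intro z
      rw [Finset.prod_insert ha]; ring

lemma exact_poly {ι : Type*} [Fintype ι] (N : ℕ) (ω : ℝ) (x w : ι → ℂ)
    (hexact : ∀ k < N, ∑ j, w j * (x j) ^ k = oscJ (fun z => z ^ k) ω)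
    (p : Polynomial ℂ) (hp : p.degree < (N : ℕ)) :
    ∑ j, w j * p.eval (x j) = oscJ (fun z => p.eval z) ω := by
  have hs : ∀ z, p.eval z = ∑ k ∈ Finset.range N, p.coeff k * z ^ k := by
    intro z
    rcases eq_or_ne p 0 with h0 | h0
    · simp [h0]
    · exact Polynomial.eval_eq_sum_range' ((Polynomial.natDegree_lt_iff_degree_lt h0).2 hp) z
  have hJ : oscJ (fun z => p.eval z) ω = ∑ k ∈ Finset.range N, p.coeff k * oscJ (fun z => z ^ k) ω := by
    simp only [← oscJ_smul]
    unfold oscJ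
    rw [← intervalIntegral.integral_finsetSum]
    · simp only [hs, Finset.sum_mul]
    · intro k _
      exact oscJ_integrable (fun z => p.coeff k * z ^ k) (by fun_prop) ω
  rw [hJ]
  simp only [hs, Finset.mul_sum]
  rw [Finset.sum_comm]
  refine Finset.sum_congr rfl fun k hk => ?_
  rw [← hexact k (Finset.mem_range.1 hk), Finset.mul_sum]
  refine Finset.sum_congr rfl fun j _ => ?_
  ring

lemma prod_lower {ι : Type*} (s : Finset ι) (y : ι → ℂ) (a : ℝ) (ha : 0 ≤ a)
    (h : ∀ k ∈ s, a ≤ ‖y k‖) : a ^ s.card ≤ ‖∏ k ∈ s, y k‖ := by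
  rw [norm_prod, ← Finset.prod_const]
  exact Finset.prod_le_prod (fun _ _ => ha) h

lemma card_left (n : ℕ) : (Finset.univ.filter (fun k : Fin (2 * n) => (k : ℕ) < n)).card = n := by
  rw [Fin.card_filter_val_lt]; omega

lemma card_right (n : ℕ) : (Finset.univ.filter (fun k : Fin (2 * n) => ¬ (k : ℕ) < n)).card = n := by
  have := Finset.card_filter_add_card_filter_not (s := (Finset.univ : Finset (Fin (2 * n))))
    (fun k : Fin (2 * n) => (k : ℕ) < n)
  rw [card_left, Finset.card_univ, Fintype.card_fin] at this
  omega

lemma weight_bound (n N : ℕ) (hn : 1 ≤ n) (hN : 2 * n ≤ N) (Ω B c : ℝ) (hΩ : 0 < Ω) (hB : 0 < B)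
    (hc : 0 < c) (x w : ℝ → Fin (2 * n) → ℂ)
    (hexact : ∀ ω ≥ Ω, ∀ k < N, ∑ j, w ω j * (x ω j) ^ k = oscJ (fun z => z ^ k) ω)
    (hl : ∀ ω ≥ Ω, ∀ j : Fin (2 * n), (j : ℕ) < n → ω * ‖x ω j + 1‖ ≤ B)
    (hr : ∀ ω ≥ Ω, ∀ j : Fin (2 * n), ¬ (j : ℕ) < n → ω * ‖x ω j - 1‖ ≤ B)
    (hsep : ∀ ω ≥ Ω, ∀ i j : Fin (2 * n), i ≠ j → c / ω ≤ ‖x ω i - x ω j‖) (j : Fin (2 * n)) :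
    ∃ W : ℝ, 0 ≤ W ∧ ∀ ω ≥ Ω, ‖w ω j‖ ≤ W / ω := by
  classical
  set L := (Finset.univ.filter (fun k : Fin (2 * n) => (k : ℕ) < n)).erase j with hL
  set R := (Finset.univ.filter (fun k : Fin (2 * n) => ¬ (k : ℕ) < n)).erase j with hR
  have hLc : n - 1 ≤ L.card := by
    have := Finset.pred_card_le_card_erase (a := j)
      (s := (Finset.univ.filter (fun k : Fin (2 * n) => (k : ℕ) < n)))
    rwa [card_left] at this
  have hRc : n - 1 ≤ R.card := by
    have := Finset.pred_card_le_card_erase (a := j)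
      (s := (Finset.univ.filter (fun k : Fin (2 * n) => ¬ (k : ℕ) < n)))
    rwa [card_right] at this
  obtain ⟨C, hC0, hC⟩ := oscJ_cluster B Ω hB.le hΩ L R 0 0 (n - 1) hLc hRc
  set d : ℝ := min 1 (c / (2 * B)) with hd
  have hd0 : 0 < d := lt_min one_pos (by positivity)
  have hcross : ∀ ω ≥ Ω, ∀ k l : Fin (2 * n), (k : ℕ) < n → ¬ (l : ℕ) < n →
      d ≤ ‖x ω k - x ω l‖ := by
    intro ω hω k l hk hl'
    have hω0 : 0 < ω := hΩ.trans_le hω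
    rcases le_total (2 * B) ω with h | h
    · refine (min_le_left _ _).trans ?_
      have h1 := hl ω hω k hk
      have h2 := hr ω hω l hl'
      have h3 : (2 : ℝ) ≤ ‖x ω k + 1‖ + ‖x ω k - x ω l‖ + ‖x ω l - 1‖ := by
        have : (2 : ℂ) = (x ω k + 1) - (x ω k - x ω l) - (x ω l - 1) := by ring
        have h4 : ‖(2 : ℂ)‖ = 2 := by simp
        rw [← h4, this]
        exact (norm_sub_le _ _).trans (add_le_add_left (norm_sub_le _ _) _)
      have h5 : ‖x ω k + 1‖ ≤ 1 / 2 := by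
        by_contra hh
        push Not at hh
        nlinarith
      have h6 : ‖x ω l - 1‖ ≤ 1 / 2 := by
        by_contra hh
        push Not at hh
        nlinarith
      linarith
    · refine (min_le_right _ _).trans (le_trans ?_ (hsep ω hω k l ?_))
      · gcongr
      · rintro rfl; exact hl' hk
  have hlow : ∃ D : ℝ, 0 < D ∧ ∀ ω ≥ Ω, D / ω ^ (n - 1) ≤
      ‖(∏ k ∈ L, (x ω j - x ω k)) * ∏ k ∈ R, (x ω j - x ω k)‖ := by
    by_cases hj : (j : ℕ) < n
    · refine ⟨c ^ (n - 1) * d ^ R.card, by positivity, fun ω hω => ?_⟩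
      have hω0 : 0 < ω := hΩ.trans_le hω
      have hcard : L.card = n - 1 := by
        rw [hL, Finset.card_erase_of_mem (by simp [hj]), card_left]
      have h1 := prod_lower L (fun k => x ω j - x ω k) (c / ω) (by positivity) (fun k hk =>
        hsep ω hω j k (Finset.ne_of_mem_erase hk).symm)
      have h2 := prod_lower R (fun k => x ω j - x ω k) d hd0.le (fun k hk =>
        hcross ω hω j k hj (Finset.mem_filter.1 (Finset.mem_of_mem_erase hk)).2)
      rw [hcard, div_pow] at h1
      rw [norm_mul, mul_div_right_comm]
      gcongr
    · refine ⟨d ^ L.card * c ^ (n - 1), by positivity, fun ω hω => ?_⟩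
      have hω0 : 0 < ω := hΩ.trans_le hω
      have hcard : R.card = n - 1 := by
        rw [hR, Finset.card_erase_of_mem (by simp [hj]; omega), card_right]
      have h1 := prod_lower R (fun k => x ω j - x ω k) (c / ω) (by positivity) (fun k hk =>
        hsep ω hω j k (Finset.ne_of_mem_erase hk).symm)
      have h2 := prod_lower L (fun k => x ω j - x ω k) d hd0.le (fun k hk => by
        rw [norm_sub_rev]
        exact hcross ω hω k j (Finset.mem_filter.1 (Finset.mem_of_mem_erase hk)).2 hj)
      rw [hcard, div_pow] at h1
      rw [norm_mul, mul_div_assoc]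
      gcongr
  obtain ⟨D, hD0, hD⟩ := hlow
  refine ⟨C / D, by positivity, fun ω hω => ?_⟩
  have hω0 : 0 < ω := hΩ.trans_le hω
  have hsplit : ∀ y : Fin (2 * n) → ℂ, (∏ k ∈ Finset.univ.erase j, y k) =
      (∏ k ∈ L, y k) * ∏ k ∈ R, y k := by
    intro y
    rw [hL, hR, ← Finset.filter_erase, ← Finset.filter_erase, Finset.prod_filter_mul_prod_filter_not]
  set P : Polynomial ℂ := ∏ k ∈ Finset.univ.erase j, (Polynomial.X - Polynomial.C (x ω k)) with hP
  have hPe : ∀ z, P.eval z = (∏ k ∈ L, (z - x ω k)) * ∏ k ∈ R, (z - x ω k) := by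
    intro z
    rw [← hsplit, hP, Polynomial.eval_prod]
    simp
  have hPd : P.degree < (N : ℕ) := by
    rw [hP, Polynomial.degree_prod]
    simp only [Polynomial.degree_X_sub_C, Finset.sum_const, Finset.card_erase_of_mem (Finset.mem_univ j),
      Finset.card_univ, Fintype.card_fin, nsmul_eq_mul, mul_one]
    exact_mod_cast (by omega)
  have hQ := exact_poly N ω (x ω) (w ω) (hexact ω hω) P hPd
  rw [Finset.sum_eq_single j] at hQ
  · have h1 := hC ω hω (x ω)
      (fun i hi => hl ω hω i (Finset.mem_filter.1 (Finset.mem_of_mem_erase hi)).2)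
      (fun i hi => hr ω hω i (Finset.mem_filter.1 (Finset.mem_of_mem_erase hi)).2)
    simp only [pow_zero, mul_one, ← hPe] at h1
    rw [← hQ, norm_mul] at h1
    have h2 := hD ω hω
    rw [← hPe] at h2
    have h3 : ‖w ω j‖ * (D / ω ^ (n - 1)) ≤ C / ω ^ (n - 1 + 1) :=
      (mul_le_mul_of_nonneg_left h2 (norm_nonneg _)).trans h1
    rw [pow_succ, ← div_div] at h3
    rw [div_div, le_div_iff₀ (by positivity)]
    have hp : 0 < ω ^ (n - 1) := by positivity
    field_simp at h3
    linarith
  · intro k _ hk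
    rw [hP, Polynomial.eval_prod, Finset.prod_eq_zero (i := k) (by simp [hk]) (by simp), mul_zero]
  · simp

theorem asymptotic_order_from_polynomial_order
    (n N : ℕ) (hn : 1 ≤ n) (hN : 2 * n ≤ N) (Ω : ℝ) (hΩ : 0 < Ω)
    (x w : ℝ → Fin (2 * n) → ℂ)
    (hexact : ∀ ω ≥ Ω, ∀ k < N,
      ∑ j, w ω j * (x ω j) ^ k =
        ∫ t in (-1 : ℝ)..1, (t : ℂ) ^ k * Complex.exp (Complex.I * ω * t))
    (hcluster : ∃ B : ℝ, ∀ ω ≥ Ω, ∀ j : Fin (2 * n),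
      ((j : ℕ) < n → ω * ‖x ω j + 1‖ ≤ B) ∧ (n ≤ (j : ℕ) → ω * ‖x ω j - 1‖ ≤ B))
    (hsep : ∃ c : ℝ, 0 < c ∧ ∀ ω ≥ Ω, ∀ i j : Fin (2 * n), i ≠ j →
      c / ω ≤ ‖x ω i - x ω j‖) :
    ∀ f : ℂ → ℂ, Differentiable ℂ f → ∃ C : ℝ, ∀ ω ≥ Ω,
      ‖(∑ j, w ω j * f (x ω j)) -
          ∫ t in (-1 : ℝ)..1, f (t : ℂ) * Complex.exp (Complex.I * ω * t)‖ ≤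
        C / ω ^ (N / 2 + 1) := by
  intro f hf
  obtain ⟨B0, hB0⟩ := hcluster
  obtain ⟨c, hc, hsep⟩ := hsep
  set B : ℝ := max B0 1 with hBdef
  have hB : 0 < B := lt_max_of_lt_right one_pos
  have hl : ∀ ω ≥ Ω, ∀ j : Fin (2 * n), (j : ℕ) < n → ω * ‖x ω j + 1‖ ≤ B :=
    fun ω hω j hj => ((hB0 ω hω j).1 hj).trans (le_max_left _ _)
  have hr : ∀ ω ≥ Ω, ∀ j : Fin (2 * n), ¬ (j : ℕ) < n → ω * ‖x ω j - 1‖ ≤ B :=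
    fun ω hω j hj => ((hB0 ω hω j).2 (not_lt.1 hj)).trans (le_max_left _ _)
  have hexact' : ∀ ω ≥ Ω, ∀ k < N, ∑ j, w ω j * (x ω j) ^ k = oscJ (fun z => z ^ k) ω := hexact
  have hw := weight_bound n N hn hN Ω B c hΩ hB hc x w hexact' hl hr hsep
  choose W hW0 hW using hw
  set M := N / 2 with hM
  obtain ⟨p, g, hg, hp, hfe⟩ := hermite_split f hf M
  have hpN : p.degree < (N : ℕ) := hp.trans_le (by exact_mod_cast (by omega))
  obtain ⟨C1, hC10, hC1⟩ := oscJ_decay M g hg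
  obtain ⟨G, hG⟩ := (isCompact_closedBall (0 : ℂ) (1 + B / Ω)).exists_bound_of_continuousOn
    hg.continuous.continuousOn
  have hnode : ∀ ω ≥ Ω, ∀ j, ‖x ω j‖ ≤ 1 + B / Ω ∧ ‖x ω j ^ 2 - 1‖ ≤ B * (2 + B / Ω) / ω := by
    intro ω hω j
    have hω0 : 0 < ω := hΩ.trans_le hω
    have aux : ∀ y e : ℂ, ‖e‖ = 1 → ω * ‖y - e‖ ≤ B →
        ‖y‖ ≤ 1 + B / Ω ∧ ‖y - e‖ * ‖y + e‖ ≤ B * (2 + B / Ω) / ω := by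
      intro y e he hy
      have h1 : ‖y - e‖ ≤ B / ω := by rw [le_div_iff₀ hω0]; linarith
      have h2 : B / ω ≤ B / Ω := by gcongr
      have h3 : ‖y‖ ≤ 1 + B / Ω := by
        have : ‖y‖ ≤ ‖y - e‖ + ‖e‖ := by simpa using norm_add_le (y - e) e
        linarith
      refine ⟨h3, ?_⟩
      have h4 : ‖y + e‖ ≤ 2 + B / Ω := (norm_add_le _ _).trans (by linarith)
      rw [mul_div_right_comm]
      gcongr
    by_cases hj : (j : ℕ) < n
    · have := aux (x ω j) (-1) (by simp) (by simpa using hl ω hω j hj)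
      rwa [← norm_mul, show (x ω j - -1) * (x ω j + -1) = x ω j ^ 2 - 1 by ring] at this
    · have := aux (x ω j) 1 (by simp) (hr ω hω j hj)
      rwa [← norm_mul, show (x ω j - 1) * (x ω j + 1) = x ω j ^ 2 - 1 by ring] at this
  refine ⟨(∑ j, W j * ((B * (2 + B / Ω)) ^ M * |G|)) + C1, fun ω hω => ?_⟩
  have hω0 : 0 < ω := hΩ.trans_le hω
  change ‖(∑ j, w ω j * f (x ω j)) - oscJ f ω‖ ≤ _
  have hgc := hg.continuous
  have e1 : oscJ f ω = oscJ (fun z => p.eval z) ω + oscJ (fun z => (z ^ 2 - 1) ^ M * g z) ω := by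
    rw [← oscJ_add _ _ p.continuous (by fun_prop)]
    congr 1
    exact funext hfe
  have e2 : (∑ j, w ω j * f (x ω j)) - oscJ f ω =
      (∑ j, w ω j * ((x ω j ^ 2 - 1) ^ M * g (x ω j))) -
        oscJ (fun z => (z ^ 2 - 1) ^ M * g z) ω := by
    rw [e1, ← exact_poly N ω (x ω) (w ω) (hexact' ω hω) p hpN]
    simp only [hfe, mul_add, Finset.sum_add_distrib]
    ring
  rw [e2, add_div, Finset.sum_div]
  refine (norm_sub_le _ _).trans (add_le_add ((norm_sum_le _ _).trans (Finset.sum_le_sum ?_))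
    (hC1 ω hω0))
  intro j _
  obtain ⟨h1, h2⟩ := hnode ω hω j
  have h3 : ‖g (x ω j)‖ ≤ |G| := (hG _ (by simpa using h1)).trans (le_abs_self _)
  rw [norm_mul, norm_mul, norm_pow]
  have hW' := hW j ω hω
  have hWj := hW0 j
  calc ‖w ω j‖ * (‖x ω j ^ 2 - 1‖ ^ M * ‖g (x ω j)‖)
      ≤ (W j / ω) * ((B * (2 + B / Ω) / ω) ^ M * |G|) := by gcongr
    _ = _ := by
      rw [div_pow, pow_succ]
      field_simp
end

section
/- Let n ≥ 1, let ξ_1,…,ξ_n be pairwise distinct positive reals and η_1,…,η_n reals such that Σ_{j=1}^{n} η_j·q(ξ_j) = ∫_{0}^{∞} q(t)·e^{−t} dt for every polynomial q of degree ≤ 2n−1 (an n-point Gauss–Laguerre rule). Let Ω > 0 and let p : [Ω,∞) → ℂ[X] assign to each ω a monic polynomial p(ω) of degree 2n with ∫_{−1}^{1} p(ω)(x)·x^k·e^{iωx} dx = 0 for every k = 0,…,2n−1, and assume the coefficients of p(ω) are uniformly bounded: there is B with |coeff_k(p(ω))| ≤ B for all k and all ω ≥ Ω. Then there exists C such that for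 every ω ≥ Ω, every j = 1,…,n and each sign s ∈ {−1, +1}, the evaluation at the superinterpolation point satisfies |p(ω)(s + i·ξ_j/ω)| ≤ C·ω^{−n−1}; that is, p(ω) evaluated at the 2n superinterpolation points is O(ω^{−n−1}) as ω → ∞. -/
open Polynomial MeasureTheory

/-- sum of scaled derivatives -/
noncomputable def Tp (N : ℕ) (z : ℂ) (q : Polynomial ℂ) : Polynomial ℂ :=
  ∑ k ∈ Finset.range N, C (z ^ k) * derivative^[k] q

lemma Tp_ode (N : ℕ) (z : ℂ) (q : Polynomial ℂ) (hq : q.natDegree < N) :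
    Tp N z q - C z * derivative (Tp N z q) = q := by
  have h : ∀ M, Tp M z q - C z * derivative (Tp M z q) = q - C (z ^ M) * derivative^[M] q := by
    intro M
    induction M with
    | zero => simp [Tp]
    | succ M ih =>
      have e : Tp (M + 1) z q = Tp M z q + C (z ^ M) * derivative^[M] q := by
        simp [Tp, Finset.sum_range_succ]
      rw [e, derivative_add, derivative_C_mul, ← Function.iterate_succ_apply' (f := derivative)]
      have : C (z ^ (M + 1)) = C z * (C (z ^ M) : Polynomial ℂ) := by
        rw [← C_mul, pow_succ']
      rw [this]
      linear_combination ih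
  rw [h N, iterate_derivative_eq_zero hq]
  simp

lemma Tp_norm_eq (N : ℕ) (ω : ℝ) (hω : 0 < ω) (q : Polynomial ℂ) (hq : q.natDegree < N)
    (h0 : ∫ x in (-1 : ℝ)..1, q.eval (x : ℂ) * Complex.exp (Complex.I * ω * x) = 0) :
    ‖(Tp N (Complex.I / ω) q).eval 1‖ = ‖(Tp N (Complex.I / ω) q).eval (-1)‖ := by
  set P := Tp N (Complex.I / ω) q with hP
  have hω' : (ω : ℂ) ≠ 0 := by exact_mod_cast hω.ne'
  have ode : ∀ x : ℂ, P.eval x - Complex.I / ω * (derivative P).eval x = q.eval x := by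
    intro x
    have := congrArg (Polynomial.eval x) (Tp_ode N (Complex.I / ω) q hq)
    simpa using this
  have hd : ∀ x : ℝ, HasDerivAt (fun x : ℝ => P.eval (x : ℂ) * Complex.exp (Complex.I * ω * x))
      ((Complex.I * ω) * (q.eval (x : ℂ) * Complex.exp (Complex.I * ω * x))) x := by
    intro x
    have h1 : HasDerivAt (fun y : ℂ => P.eval y) ((derivative P).eval (x : ℂ)) (x : ℂ) :=
      P.hasDerivAt _
    have h2 : HasDerivAt (fun y : ℂ => Complex.exp (Complex.I * ω * y))
        (Complex.exp (Complex.I * ω * x) * (Complex.I * ω * 1)) (x : ℂ) :=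
      ((hasDerivAt_id (x : ℂ)).const_mul (Complex.I * ω)).cexp
    refine HasDerivAt.congr_deriv (h1.mul h2).comp_ofReal ?_
    rw [← ode]
    have : Complex.I * Complex.I = -1 := Complex.I_mul_I
    field_simp
    linear_combination ((derivative P).eval (x : ℂ)) * this
  have key := intervalIntegral.integral_eq_sub_of_hasDerivAt (a := -1) (b := 1)
    (fun x _ => hd x) (by
      apply Continuous.intervalIntegrable
      fun_prop)
  rw [intervalIntegral.integral_const_mul, h0, mul_zero] at key
  have key2 := congrArg norm (sub_eq_zero.mp key.symm)
  have e : ∀ x : ℝ, ‖Complex.exp (Complex.I * ω * x)‖ = 1 := by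
    intro x
    have : Complex.I * ω * x = ((ω * x : ℝ) : ℂ) * Complex.I := by push_cast; ring
    rw [this, Complex.norm_exp_ofReal_mul_I]
  rw [norm_mul, norm_mul, e, e] at key2
  simpa using key2

lemma integrable_pow_exp (k : ℕ) :
    IntegrableOn (fun t : ℝ => t ^ k * Real.exp (-t)) (Set.Ioi 0) := by
  have := Real.GammaIntegral_convergent (s := (k : ℝ) + 1) (by positivity)
  refine this.congr_fun (fun t ht => ?_) measurableSet_Ioi
  simp [mul_comm]

lemma integral_pow_exp (k : ℕ) :
    ∫ t in Set.Ioi (0 : ℝ), t ^ k * Real.exp (-t) = (k.factorial : ℝ) := by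
  rw [← Real.Gamma_nat_eq_factorial, Real.Gamma_eq_integral (by positivity)]
  refine setIntegral_congr_fun measurableSet_Ioi (fun t ht => ?_)
  simp [mul_comm]

lemma integrable_poly_exp (q : Polynomial ℝ) :
    IntegrableOn (fun t : ℝ => q.eval t * Real.exp (-t)) (Set.Ioi 0) := by
  have : (fun t : ℝ => q.eval t * Real.exp (-t)) = fun t => ∑ k ∈ Finset.range (q.natDegree + 1),
      q.coeff k * (t ^ k * Real.exp (-t)) := by
    ext t
    rw [eval_eq_sum_range, Finset.sum_mul]
    simp [mul_assoc]
  rw [this]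
  exact integrable_finsetSum _ (fun k _ => (integrable_pow_exp k).const_mul _)

lemma weight_ne_zero (n : ℕ) (hn : 1 ≤ n) (ξ η : Fin n → ℝ)
    (hGL : ∀ q : Polynomial ℝ, q.natDegree ≤ 2 * n - 1 →
      ∑ j, η j * q.eval (ξ j) = ∫ t in Set.Ioi (0 : ℝ), q.eval t * Real.exp (-t))
    (j : Fin n) : η j ≠ 0 := by
  intro h
  set r : Polynomial ℝ := ∏ l ∈ Finset.univ.erase j, (X - C (ξ l)) with hr
  have hrm : r.Monic := monic_prod_of_monic _ _ (fun l _ => monic_X_sub_C _)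
  have hdeg : r.natDegree = n - 1 := by
    rw [hr, natDegree_prod_of_monic _ _ (fun l _ => monic_X_sub_C _)]
    simp
  have hdeg2 : (r ^ 2).natDegree ≤ 2 * n - 1 := by
    rw [hrm.natDegree_pow, hdeg]; omega
  have h1 := hGL _ hdeg2
  rw [Finset.sum_eq_zero] at h1
  · have hpos : 0 < ∫ t in Set.Ioi (0 : ℝ), (r ^ 2).eval t * Real.exp (-t) := by
      rw [setIntegral_pos_iff_support_of_nonneg_ae]
      · have hsub : Set.Ioi (0 : ℝ) \ (r.roots.toFinset : Set ℝ) ⊆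
            Function.support (fun t => (r ^ 2).eval t * Real.exp (-t)) ∩ Set.Ioi 0 := by
          intro t ht
          refine ⟨?_, ht.1⟩
          have : r.eval t ≠ 0 := by
            intro h0
            apply ht.2
            simp [hrm.ne_zero, h0]
          simp [this]
        refine lt_of_lt_of_le ?_ (measure_mono hsub)
        rw [measure_sdiff_null (Finset.measure_zero _ _)]
        simp
      · refine Filter.Eventually.of_forall (fun t => ?_)
        simp only [eval_pow, Pi.zero_apply]
        positivity
      · exact integrable_poly_exp _
    rw [← h1] at hpos
    exact lt_irrefl _ hpos
  · intro l _
    by_cases hl : l = j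
    · simp [hl, h]
    · have : r.eval (ξ l) = 0 := by
        rw [hr, eval_prod]
        exact Finset.prod_eq_zero (i := l) (by simp [hl]) (by simp)
      simp [this]

lemma gl_diff (n : ℕ) (hn : 1 ≤ n) (ξ η : Fin n → ℝ)
    (hGL : ∀ q : Polynomial ℝ, q.natDegree ≤ 2 * n - 1 →
      ∑ j, η j * q.eval (ξ j) = ∫ t in Set.Ioi (0 : ℝ), q.eval t * Real.exp (-t))
    (N : ℕ) (z x : ℂ) (q : Polynomial ℂ) (hq : q.natDegree < N) :
    (∑ j, (η j : ℂ) * q.eval (x + z * ξ j)) - (Tp N z q).eval x =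
      ∑ k ∈ Finset.range N, if k < 2 * n then 0 else
        z ^ k * (((∑ j, η j * ξ j ^ k - k.factorial : ℝ) : ℂ) * (hasseDeriv k q).eval x) := by
  have h1 : ∀ y : ℂ, q.eval (x + y) = ∑ k ∈ Finset.range N, (hasseDeriv k q).eval x * y ^ k := by
    intro y
    have : q.eval (x + y) = (taylor x q).eval y := by rw [taylor_eval, add_comm]
    rw [this, eval_eq_sum_range' (n := N) (by rwa [natDegree_taylor])]
    simp [taylor_coeff]
  have h2 : (Tp N z q).eval x = ∑ k ∈ Finset.range N,
      z ^ k * ((k.factorial : ℂ) * (hasseDeriv k q).eval x) := by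
    rw [Tp, eval_finsetSum]
    refine Finset.sum_congr rfl (fun k _ => ?_)
    rw [← factorial_smul_hasseDeriv]
    simp [nsmul_eq_mul]
  rw [h2]
  simp_rw [h1, Finset.mul_sum]
  rw [Finset.sum_comm, ← Finset.sum_sub_distrib]
  refine Finset.sum_congr rfl (fun k _ => ?_)
  have h3 : ∑ j, (η j : ℂ) * ((hasseDeriv k q).eval x * (z * ξ j) ^ k) =
      z ^ k * (((∑ j, η j * ξ j ^ k : ℝ) : ℂ) * (hasseDeriv k q).eval x) := by
    push_cast
    rw [Finset.sum_mul, Finset.mul_sum]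
    refine Finset.sum_congr rfl (fun j _ => ?_)
    rw [mul_pow]; ring
  rw [h3]
  split_ifs with hk
  · have := hGL (X ^ k) (by rw [natDegree_X_pow]; omega)
    simp only [eval_pow, eval_X] at this
    rw [this, integral_pow_exp]
    push_cast; ring
  · push_cast; ring

/-- coefficientwise bounded on [Ω, ∞) -/
def CB (Ω : ℝ) (q : ℝ → Polynomial ℂ) : Prop :=
  ∀ k : ℕ, ∃ B : ℝ, ∀ ω ≥ Ω, ‖(q ω).coeff k‖ ≤ B

lemma CB.mul {Ω : ℝ} {p q : ℝ → Polynomial ℂ} (hp : CB Ω p) (hq : CB Ω q) :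
    CB Ω (fun ω => p ω * q ω) := by
  intro k
  choose A hA using hp
  choose B hB using hq
  refine ⟨∑ x ∈ Finset.HasAntidiagonal.antidiagonal k, A x.1 * B x.2, fun ω hω => ?_⟩
  rw [coeff_mul]
  refine (norm_sum_le _ _).trans (Finset.sum_le_sum fun x _ => ?_)
  rw [norm_mul]
  exact mul_le_mul (hA _ _ hω) (hB _ _ hω) (norm_nonneg _) ((norm_nonneg _).trans (hA _ _ hω))

lemma CB.prod {ι : Type*} {Ω : ℝ} (s : Finset ι) (f : ι → ℝ → Polynomial ℂ)
    (h : ∀ i, CB Ω (f i)) : CB Ω (fun ω => ∏ i ∈ s, f i ω) := by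
  classical
  induction s using Finset.induction_on with
  | empty => exact fun k => ⟨‖(1 : Polynomial ℂ).coeff k‖, fun ω _ => by simp⟩
  | insert a s ha ih =>
    simp_rw [Finset.prod_insert ha]
    exact (h a).mul ih

lemma CB.linear {Ω : ℝ} (hΩ : 0 < Ω) (s : ℂ) (x : ℝ) :
    CB Ω (fun ω => X - C (s + Complex.I / ω * x)) := by
  intro k
  refine ⟨1 + (‖s‖ + |x| / Ω), fun ω hω => ?_⟩
  have hω0 : 0 < ω := lt_of_lt_of_le hΩ hω
  rw [coeff_sub]
  refine (norm_sub_le _ _).trans (add_le_add ?_ ?_)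
  · rw [coeff_X]; split_ifs <;> simp
  · rw [coeff_C]
    split_ifs
    · refine (norm_add_le _ _).trans (add_le_add le_rfl ?_)
      rw [norm_mul, norm_div, Complex.norm_I, Complex.norm_real, Complex.norm_real,
        Real.norm_eq_abs, Real.norm_eq_abs, abs_of_pos hω0, one_div_mul_eq_div]
      gcongr
    · rw [norm_zero]; positivity

lemma CB.hasse_eval {Ω : ℝ} {q : ℝ → Polynomial ℂ} (hq : CB Ω q) (N : ℕ)
    (hN : ∀ ω ≥ Ω, (q ω).natDegree < N) (k : ℕ) (x : ℂ) :
    ∃ B : ℝ, ∀ ω ≥ Ω, ‖(hasseDeriv k (q ω)).eval x‖ ≤ B := by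
  choose A hA using hq
  refine ⟨∑ i ∈ Finset.range N, ((i + k).choose k : ℝ) * A (i + k) * ‖x‖ ^ i, fun ω hω => ?_⟩
  rw [eval_eq_sum_range' (n := N)
    (lt_of_le_of_lt ((natDegree_hasseDeriv_le _ _).trans (Nat.sub_le _ _)) (hN ω hω))]
  refine (norm_sum_le _ _).trans (Finset.sum_le_sum fun i _ => ?_)
  rw [hasseDeriv_coeff, norm_mul, norm_mul, norm_pow, Complex.norm_natCast]
  gcongr
  exact hA _ _ hω

lemma gl_err (n : ℕ) (hn : 1 ≤ n) (ξ η : Fin n → ℝ)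
    (hGL : ∀ q : Polynomial ℝ, q.natDegree ≤ 2 * n - 1 →
      ∑ j, η j * q.eval (ξ j) = ∫ t in Set.Ioi (0 : ℝ), q.eval t * Real.exp (-t))
    (Ω : ℝ) (hΩ : 0 < Ω) (N : ℕ) (x : ℂ) (q : ℝ → Polynomial ℂ) (hq : CB Ω q)
    (hN : ∀ ω ≥ Ω, (q ω).natDegree < N) :
    ∃ K : ℝ, ∀ ω ≥ Ω, ‖(∑ j, (η j : ℂ) * (q ω).eval (x + Complex.I / ω * ξ j)) -
      (Tp N (Complex.I / ω) (q ω)).eval x‖ ≤ K / ω ^ (2 * n) := by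
  choose B hB using fun k => hq.hasse_eval N hN k x
  refine ⟨∑ k ∈ Finset.range N, (1 / Ω) ^ (k - 2 * n) *
    (|∑ j, η j * ξ j ^ k - k.factorial| * |B k|), fun ω hω => ?_⟩
  have hω0 : 0 < ω := lt_of_lt_of_le hΩ hω
  rw [gl_diff n hn ξ η hGL N _ x _ (hN ω hω), Finset.sum_div]
  refine (norm_sum_le _ _).trans (Finset.sum_le_sum fun k _ => ?_)
  split_ifs with hk
  · rw [norm_zero]; positivity
  · rw [norm_mul, norm_mul, Complex.norm_real, norm_pow, norm_div, Complex.norm_I,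
      Complex.norm_real, Real.norm_eq_abs, Real.norm_eq_abs, abs_of_pos hω0]
    obtain ⟨m, rfl⟩ := Nat.exists_eq_add_of_le (not_lt.mp hk)
    rw [Nat.add_sub_cancel_left, pow_add, mul_assoc, div_pow, one_pow, one_div_mul_eq_div]
    gcongr
    exact (hB _ ω hω).trans (le_abs_self _)

lemma orth_mul (n : ℕ) (ω : ℝ) (p g : Polynomial ℂ) (hg : g.natDegree < 2 * n)
    (horth : ∀ k < 2 * n, ∫ x in (-1 : ℝ)..1,
      p.eval (x : ℂ) * (x : ℂ) ^ k * Complex.exp (Complex.I * ω * x) = 0) :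
    ∫ x in (-1 : ℝ)..1, (p * g).eval (x : ℂ) * Complex.exp (Complex.I * ω * x) = 0 := by
  have : ∀ x : ℝ, (p * g).eval (x : ℂ) * Complex.exp (Complex.I * ω * x) =
      ∑ k ∈ Finset.range (2 * n), g.coeff k *
        (p.eval (x : ℂ) * (x : ℂ) ^ k * Complex.exp (Complex.I * ω * x)) := by
    intro x
    rw [eval_mul, eval_eq_sum_range' (p := g) hg, Finset.mul_sum, Finset.sum_mul]
    exact Finset.sum_congr rfl (fun k _ => by ring)
  simp_rw [this]
  rw [intervalIntegral.integral_finsetSum]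
  · refine Finset.sum_eq_zero (fun k hk => ?_)
    rw [intervalIntegral.integral_const_mul, horth k (Finset.mem_range.mp hk), mul_zero]
  · intro k _
    apply Continuous.intervalIntegrable
    fun_prop

lemma one_point
    (n : ℕ) (hn : 1 ≤ n) (ξ η : Fin n → ℝ)
    (hξinj : Function.Injective ξ)
    (hGL : ∀ q : Polynomial ℝ, q.natDegree ≤ 2 * n - 1 →
      ∑ j, η j * q.eval (ξ j) = ∫ t in Set.Ioi (0 : ℝ), q.eval t * Real.exp (-t))
    (Ω : ℝ) (hΩ : 0 < Ω) (p : ℝ → Polynomial ℂ)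
    (hmonic : ∀ ω ≥ Ω, (p ω).Monic ∧ (p ω).natDegree = 2 * n)
    (horth : ∀ ω ≥ Ω, ∀ k < 2 * n, ∫ x in (-1 : ℝ)..1,
      (p ω).eval (x : ℂ) * (x : ℂ) ^ k * Complex.exp (Complex.I * ω * x) = 0)
    (hbound : ∃ B : ℝ, ∀ ω ≥ Ω, ∀ k : ℕ, ‖(p ω).coeff k‖ ≤ B)
    (j : Fin n) (s : ℂ) (hs : s = 1 ∨ s = -1) :
    ∃ C : ℝ, ∀ ω ≥ Ω,
      ‖(p ω).eval (s + Complex.I / ω * ξ j)‖ ≤ C / ω ^ (n + 1) := by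
  set g : ℝ → Polynomial ℂ := fun ω =>
    (∏ l ∈ Finset.univ.erase j, (X - C (s + Complex.I / ω * ξ l))) *
      ∏ l, (X - C (-s + Complex.I / ω * ξ l)) with hgdef
  have hgCB : CB Ω g :=
    (CB.prod _ (fun l ω => X - C (s + Complex.I / ω * ξ l)) (fun l => CB.linear hΩ s (ξ l))).mul
    (CB.prod _ (fun l ω => X - C (-s + Complex.I / ω * ξ l)) (fun l => CB.linear hΩ (-s) (ξ l)))
  have hpCB : CB Ω p := by
    obtain ⟨B, hB⟩ := hbound
    exact fun k => ⟨B, fun ω hω => hB ω hω k⟩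
  have hgdeg : ∀ ω, (g ω).natDegree < 2 * n := by
    intro ω
    have h1 : (g ω).natDegree = (n - 1) + n := by
      rw [hgdef]
      simp only
      rw [Monic.natDegree_mul (monic_prod_of_monic _ _ (fun l _ => monic_X_sub_C _))
        (monic_prod_of_monic _ _ (fun l _ => monic_X_sub_C _)),
        natDegree_prod_of_monic _ _ (fun l _ => monic_X_sub_C _),
        natDegree_prod_of_monic _ _ (fun l _ => monic_X_sub_C _)]
      simp only [natDegree_X_sub_C]
      simp
    omega
  have hqdeg : ∀ ω ≥ Ω, (p ω * g ω).natDegree < 4 * n := by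
    intro ω hω
    have := natDegree_mul_le (p := p ω) (q := g ω)
    have := hgdeg ω
    have := (hmonic ω hω).2
    omega
  obtain ⟨K1, hK1⟩ := gl_err n hn ξ η hGL Ω hΩ (4 * n) s _ (hpCB.mul hgCB) hqdeg
  obtain ⟨K2, hK2⟩ := gl_err n hn ξ η hGL Ω hΩ (4 * n) (-s) _ (hpCB.mul hgCB) hqdeg
  have hη := weight_ne_zero n hn ξ η hGL j
  set D : ℝ := ∏ l ∈ Finset.univ.erase j, |ξ j - ξ l| with hD
  have hDpos : 0 < D := Finset.prod_pos (fun l hl => by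
    rw [abs_pos, sub_ne_zero]
    intro h
    exact (Finset.ne_of_mem_erase hl) (hξinj h).symm)
  refine ⟨(K1 + K2) / (|η j| * (D * 2 ^ n)), fun ω hω => ?_⟩
  have hω0 : 0 < ω := lt_of_lt_of_le hΩ hω
  have hT : ‖(Tp (4 * n) (Complex.I / ω) (p ω * g ω)).eval s‖ =
      ‖(Tp (4 * n) (Complex.I / ω) (p ω * g ω)).eval (-s)‖ := by
    have := Tp_norm_eq (4 * n) ω hω0 _ (hqdeg ω hω)
      (orth_mul n ω (p ω) (g ω) (hgdeg ω) (horth ω hω))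
    rcases hs with rfl | rfl
    · exact this
    · rw [neg_neg]; exact this.symm
  have h1 := hK1 ω hω
  have h2 := hK2 ω hω
  have e2 : ∑ l, (η l : ℂ) * (p ω * g ω).eval (-s + Complex.I / ω * ξ l) = 0 := by
    refine Finset.sum_eq_zero (fun l _ => ?_)
    have : (g ω).eval (-s + Complex.I / ω * ξ l) = 0 := by
      simp only [hgdef, eval_mul, eval_prod]
      rw [Finset.prod_eq_zero (s := Finset.univ) (Finset.mem_univ l) (by simp), mul_zero]
    rw [eval_mul, this]; simp
  have e1 : ∑ l, (η l : ℂ) * (p ω * g ω).eval (s + Complex.I / ω * ξ l) =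
      (η j : ℂ) * ((p ω).eval (s + Complex.I / ω * ξ j) *
        (g ω).eval (s + Complex.I / ω * ξ j)) := by
    rw [Finset.sum_eq_single j, eval_mul]
    · intro l _ hl
      have : (g ω).eval (s + Complex.I / ω * ξ l) = 0 := by
        simp only [hgdef, eval_mul, eval_prod]
        rw [Finset.prod_eq_zero (s := Finset.univ.erase j) (i := l) (by simp [hl]) (by simp),
          zero_mul]
      rw [eval_mul, this]; simp
    · simp
  rw [e1] at h1
  rw [e2, zero_sub, norm_neg] at h2
  have h3 : ‖(η j : ℂ) * ((p ω).eval (s + Complex.I / ω * ξ j) *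
        (g ω).eval (s + Complex.I / ω * ξ j))‖ ≤ (K1 + K2) / ω ^ (2 * n) := by
    rw [← hT] at h2
    have := norm_le_norm_sub_add ((η j : ℂ) * ((p ω).eval (s + Complex.I / ω * ξ j) *
        (g ω).eval (s + Complex.I / ω * ξ j)))
        ((Tp (4 * n) (Complex.I / ω) (p ω * g ω)).eval s)
    rw [add_div]
    linarith
  have hglow : D * 2 ^ n / ω ^ (n - 1) ≤ ‖(g ω).eval (s + Complex.I / ω * ξ j)‖ := by
    simp only [hgdef, eval_mul, eval_prod, norm_mul, norm_prod, eval_sub, eval_X, eval_C]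
    have a1 : ∏ l ∈ Finset.univ.erase j,
        ‖s + Complex.I / ω * ξ j - (s + Complex.I / ω * ξ l)‖ = D / ω ^ (n - 1) := by
      have : ∀ l, ‖s + Complex.I / ω * ξ j - (s + Complex.I / ω * ξ l)‖ = |ξ j - ξ l| / ω := by
        intro l
        have : s + Complex.I / ω * ξ j - (s + Complex.I / ω * ξ l) =
          Complex.I * ((ξ j - ξ l : ℝ) : ℂ) / ω := by push_cast; ring
        rw [this, norm_div, norm_mul, Complex.norm_I, one_mul, Complex.norm_real,
          Complex.norm_real, Real.norm_eq_abs, Real.norm_eq_abs, abs_of_pos hω0]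
      simp_rw [this]
      rw [Finset.prod_div_distrib]
      simp [hD]
    have a2 : (2 : ℝ) ^ n ≤
        ∏ l, ‖s + Complex.I / ω * ξ j - (-s + Complex.I / ω * ξ l)‖ := by
      have : (2 : ℝ) ^ n = ∏ l : Fin n, (2 : ℝ) := by simp
      rw [this]
      refine Finset.prod_le_prod (fun _ _ => by norm_num) (fun l _ => ?_)
      refine le_trans ?_ (Complex.abs_re_le_norm _)
      have : s + Complex.I / ω * ξ j - (-s + Complex.I / ω * ξ l) =
          2 * s + (((ξ j - ξ l) / ω : ℝ) : ℂ) * Complex.I := by push_cast; ring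
      rw [this, Complex.add_re, Complex.re_ofReal_mul, Complex.I_re]
      rcases hs with rfl | rfl <;> simp
    rw [a1, mul_div_right_comm]
    exact mul_le_mul_of_nonneg_left a2 (by positivity)
  have hη' : 0 < |η j| := abs_pos.mpr hη
  rw [norm_mul, norm_mul, Complex.norm_real, Real.norm_eq_abs] at h3
  set v := ‖(p ω).eval (s + Complex.I / ω * ξ j)‖
  have h4 : |η j| * (v * (D * 2 ^ n / ω ^ (n - 1))) ≤ (K1 + K2) / ω ^ (2 * n) := by
    refine le_trans ?_ h3
    gcongr
  have hpow : ω ^ (2 * n) = ω ^ (n - 1) * ω ^ (n + 1) := by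
    rw [← pow_add]; congr 1; omega
  rw [hpow] at h4
  rw [div_div, le_div_iff₀ (by positivity)]
  rw [le_div_iff₀ (by positivity)] at h4
  refine le_trans (le_of_eq ?_) h4
  field_simp

theorem orthogonal_polynomial_small_at_superinterpolation_points
    (n : ℕ) (hn : 1 ≤ n) (ξ η : Fin n → ℝ)
    (hξpos : ∀ j, 0 < ξ j) (hξinj : Function.Injective ξ)
    (hGL : ∀ q : Polynomial ℝ, q.natDegree ≤ 2 * n - 1 →
      ∑ j, η j * q.eval (ξ j) = ∫ t in Set.Ioi (0 : ℝ), q.eval t * Real.exp (-t))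
    (Ω : ℝ) (hΩ : 0 < Ω) (p : ℝ → Polynomial ℂ)
    (hmonic : ∀ ω ≥ Ω, (p ω).Monic ∧ (p ω).natDegree = 2 * n)
    (horth : ∀ ω ≥ Ω, ∀ k < 2 * n, ∫ x in (-1 : ℝ)..1,
      (p ω).eval (x : ℂ) * (x : ℂ) ^ k * Complex.exp (Complex.I * ω * x) = 0)
    (hbound : ∃ B : ℝ, ∀ ω ≥ Ω, ∀ k : ℕ, ‖(p ω).coeff k‖ ≤ B) :
    ∃ C : ℝ, ∀ ω ≥ Ω, ∀ j : Fin n, ∀ s : ℂ, (s = 1 ∨ s = -1) →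
      ‖(p ω).eval (s + Complex.I * (ξ j : ℂ) / (ω : ℂ))‖ ≤ C / ω ^ (n + 1) := by
  choose A hA using fun j => one_point n hn ξ η hξinj hGL Ω hΩ p hmonic horth hbound j 1
    (Or.inl rfl)
  choose B hB using fun j => one_point n hn ξ η hξinj hGL Ω hΩ p hmonic horth hbound j (-1)
    (Or.inr rfl)
  refine ⟨∑ j, (|A j| + |B j|), fun ω hω j s hs => ?_⟩
  have hω0 : 0 < ω := lt_of_lt_of_le hΩ hω
  have hle : |A j| + |B j| ≤ ∑ j, (|A j| + |B j|) :=
    Finset.single_le_sum (f := fun j => |A j| + |B j|) (fun i _ => by positivity)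
      (Finset.mem_univ j)
  rw [mul_div_right_comm]
  rcases hs with rfl | rfl
  · refine (hA j ω hω).trans ?_
    gcongr
    linarith [le_abs_self (A j), abs_nonneg (B j)]
  · refine (hB j ω hω).trans ?_
    gcongr
    linarith [le_abs_self (B j), abs_nonneg (A j)]
end
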